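/- arXiv:1805.06040 — 2 statements merged into one kernel-verified Lean document; each statement's English description precedes it below -/
import Mathlib

section
/- Duality formula for the discrete transport distance: for any Markov triple (X, Q, π), any admissible mean Λ, and any probability measures μ⁰, μ¹ on X, one has (1/2)·W(μ⁰,μ¹)² = sup { ⟨φ₁, μ¹⟩ − ⟨φ₀, μ⁰⟩ : φ ∈ C¹([0,1], ℝ^X) is a Hamilton–Jacobi subsolution }, where ⟨f, μ⟩ = Σ_{x∈X} f(x)μ(x). -/
open MeasureTheory
open scoped ENNReal

section Prelude

variable {X : Type*}

/-- A probability measure on a finite set, identified with its density. -/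
def IsProb [Fintype X] (μ : X → ℝ) : Prop :=
  (∀ x, 0 ≤ μ x) ∧ ∑ x, μ x = 1

/-- An admissible mean in the sense of Erbar–Maas–Wirth. -/
structure AdmissibleMean (Λ : ℝ → ℝ → ℝ) : Prop where
  contOn : ContinuousOn (fun p : ℝ × ℝ => Λ p.1 p.2) (Set.Ici 0 ×ˢ Set.Ici 0)
  smoothOn : ContDiffOn ℝ (⊤ : ℕ∞) (fun p : ℝ × ℝ => Λ p.1 p.2) (Set.Ioi 0 ×ˢ Set.Ioi 0)
  symm : ∀ s t, Λ s t = Λ t s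
  homog : ∀ c s t, 0 ≤ c → 0 ≤ s → 0 ≤ t → Λ (c * s) (c * t) = c * Λ s t
  mono : ∀ s s' t, 0 ≤ s → s ≤ s' → 0 ≤ t → Λ s t ≤ Λ s' t
  concave : ConcaveOn ℝ (Set.Ici 0 ×ˢ Set.Ici 0) (fun p : ℝ × ℝ => Λ p.1 p.2)
  nonneg : ∀ s t, 0 ≤ s → 0 ≤ t → 0 ≤ Λ s t
  normalized : Λ 1 1 = 1

/-- The convex lsc integrand `A(s,t,w)`, with values in `[0,∞]`. -/
noncomputable def Afun (Λ : ℝ → ℝ → ℝ) (s t w : ℝ) : ℝ≥0∞ :=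
  if 0 < s ∧ 0 < t then ENNReal.ofReal (w ^ 2 / Λ s t)
  else if w = 0 ∧ 0 ≤ s ∧ 0 ≤ t then 0
  else ⊤

/-- The action `𝒜(μ, V)`. -/
noncomputable def action [Fintype X] (Λ : ℝ → ℝ → ℝ) (Q : X → X → ℝ)
    (μ : X → ℝ) (V : X → X → ℝ) : ℝ≥0∞ :=
  (∑ x, ∑ y, Afun Λ (μ x * Q x y) (μ y * Q y x) (V x y)) / 2

/-- The pairing `⟨f, μ⟩ = ∑ₓ f(x) μ(x)`. -/
def dotp [Fintype X] (f μ : X → ℝ) : ℝ := ∑ x, f x * μ x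

/-- The squared discrete gradient norm `‖∇ψ‖²_μ`. -/
noncomputable def gradSq [Fintype X] (Λ : ℝ → ℝ → ℝ) (Q : X → X → ℝ)
    (μ ψ : X → ℝ) : ℝ :=
  (1 / 2) * ∑ x, ∑ y, Λ (μ x * Q x y) (μ y * Q y x) * (ψ y - ψ x) ^ 2

/-- `C¹` Hamilton–Jacobi subsolutions on `[0, T]`. -/
def IsHJ [Fintype X] (Λ : ℝ → ℝ → ℝ) (Q : X → X → ℝ) (T : ℝ) (φ : ℝ → X → ℝ) : Prop :=
  ∃ φ' : ℝ → X → ℝ,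
    (∀ x, ContinuousOn (fun t => φ' t x) (Set.Icc 0 T)) ∧
    (∀ x, ∀ t ∈ Set.Icc (0 : ℝ) T,
      HasDerivWithinAt (fun s => φ s x) (φ' t x) (Set.Icc 0 T) t) ∧
    (∀ t ∈ Set.Icc (0 : ℝ) T, ∀ μ : X → ℝ, IsProb μ →
      dotp (φ' t) μ + (1 / 2) * gradSq Λ Q μ (φ t) ≤ 0)

/-- The continuity equation on the time interval `[0,1]`. -/
def IsCE1 [Fintype X] (μ0 μ1 : X → ℝ) (μ : ℝ → X → ℝ) (V : ℝ → X → X → ℝ) : Prop :=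
  (∀ x, ContinuousOn (fun t => μ t x) (Set.Icc 0 1)) ∧
  (∀ x y, IntervalIntegrable (fun s => V s x y) volume 0 1) ∧
  (∀ t ∈ Set.Icc (0 : ℝ) 1, IsProb (μ t)) ∧
  μ 0 = μ0 ∧ μ 1 = μ1 ∧
  (∀ x, ∀ t ∈ Set.Icc (0 : ℝ) 1,
    μ t x = μ0 x - ∫ s in (0 : ℝ)..t, (1 / 2) * ∑ y, (V s x y - V s y x))

/-- Total action of a curve. -/
noncomputable def curveAction [Fintype X] (Λ : ℝ → ℝ → ℝ) (Q : X → X → ℝ)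
    (μ : ℝ → X → ℝ) (V : ℝ → X → X → ℝ) : ℝ≥0∞ :=
  ∫⁻ t in Set.Icc (0 : ℝ) 1, action Λ Q (μ t) (V t)

/-- The squared discrete transport distance `W(μ0, μ1)²`. -/
noncomputable def Wsq [Fintype X] (Λ : ℝ → ℝ → ℝ) (Q : X → X → ℝ)
    (μ0 μ1 : X → ℝ) : ℝ≥0∞ :=
  ⨅ (μ : ℝ → X → ℝ) (V : ℝ → X → X → ℝ) (_ : IsCE1 μ0 μ1 μ V), curveAction Λ Q μ V

/-- A Markov triple: nonnegative irreducible rates, vanishing on the diagonal,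
reversible w.r.t. the strictly positive probability measure `pm`. -/
def IsMarkovTriple [Fintype X] (Q : X → X → ℝ) (pm : X → ℝ) : Prop :=
  (∀ x y, 0 ≤ Q x y) ∧ (∀ x, Q x x = 0) ∧
  (∀ x y, Relation.ReflTransGen (fun a b => 0 < Q a b) x y) ∧
  IsProb pm ∧ (∀ x, 0 < pm x) ∧ (∀ x y, pm x * Q x y = pm y * Q y x)

/-- A subset is connected if any two of its points are joined by a path inside it
along which `Q` is positive. -/
def IsConnectedSubset (Q : X → X → ℝ) (Y : Set X) : Prop :=
  ∀ y ∈ Y, ∀ y' ∈ Y, Relation.ReflTransGen (fun a b => b ∈ Y ∧ 0 < Q a b) y y'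

/-- `T` is a retraction of `X` onto `Y`. -/
def IsRetraction [Fintype X] [DecidableEq X] (Q : X → X → ℝ) (Y : Set X) (T : X → X) : Prop :=
  (∀ x, T x ∈ Y) ∧ (∀ y ∈ Y, T y = y) ∧
  ∀ y ∈ Y, ∀ y' ∈ Y, y ≠ y' → ∀ x, T x = y →
    (∑ x' ∈ Finset.univ.filter (fun x' => T x' = y'), Q x x') ≤ Q y y'

/-- `Y` has the retraction property. -/
def HasRetractionProperty [Fintype X] [DecidableEq X] (Q : X → X → ℝ) (Y : Set X) : Prop :=
  IsConnectedSubset Q Y ∧ ∃ T : X → X, IsRetraction Q Y T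

end Prelude

namespace DiscreteTransport

open Set Filter Topology

section Mean

variable {Λ : ℝ → ℝ → ℝ}

lemma mean_mono_right (hΛ : AdmissibleMean Λ) {s t t' : ℝ} (hs : 0 ≤ s) (ht : 0 ≤ t)
    (htt' : t ≤ t') : Λ s t ≤ Λ s t' := by
  rw [hΛ.symm s t, hΛ.symm s t']
  exact hΛ.mono t t' s ht htt' hs

lemma mean_self (hΛ : AdmissibleMean Λ) {s : ℝ} (hs : 0 ≤ s) : Λ s s = s := by
  have h := hΛ.homog s 1 1 hs zero_le_one zero_le_one
  simpa [hΛ.normalized] using h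

lemma mean_pos (hΛ : AdmissibleMean Λ) {s t : ℝ} (hs : 0 < s) (ht : 0 < t) : 0 < Λ s t := by
  have hm : 0 < min s t := lt_min hs ht
  calc 0 < min s t := hm
    _ = Λ (min s t) (min s t) := (mean_self hΛ hm.le).symm
    _ ≤ Λ s (min s t) := hΛ.mono _ _ _ hm.le (min_le_left _ _) hm.le
    _ ≤ Λ s t := mean_mono_right hΛ hs.le hm.le (min_le_right _ _)

end Mean

section EdgeWeight

variable {X : Type*}

/-- The edge weights `Λ(μ(x)Q(x,y), μ(y)Q(y,x))`, extended continuously to all functions `μ`. -/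
noncomputable def edgeWeight (Λ : ℝ → ℝ → ℝ) (Q : X → X → ℝ) (μ : X → ℝ) (x y : X) : ℝ :=
  Λ (max (μ x * Q x y) 0) (max (μ y * Q y x) 0)

variable {Λ : ℝ → ℝ → ℝ} {Q : X → X → ℝ}

lemma edgeWeight_eq (hQ : ∀ x y, 0 ≤ Q x y) {μ : X → ℝ} (hμ : ∀ x, 0 ≤ μ x) (x y : X) :
    edgeWeight Λ Q μ x y = Λ (μ x * Q x y) (μ y * Q y x) := by
  rw [edgeWeight, max_eq_left (mul_nonneg (hμ x) (hQ x y)),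
    max_eq_left (mul_nonneg (hμ y) (hQ y x))]

lemma edgeWeight_nonneg (hΛ : AdmissibleMean Λ) (μ : X → ℝ) (x y : X) :
    0 ≤ edgeWeight Λ Q μ x y :=
  hΛ.nonneg _ _ (le_max_right _ _) (le_max_right _ _)

lemma continuous_edgeWeight (hΛ : AdmissibleMean Λ) (x y : X) :
    Continuous fun μ : X → ℝ => edgeWeight Λ Q μ x y := by
  refine hΛ.contOn.comp_continuous
    (f := fun μ : X → ℝ => (max (μ x * Q x y) 0, max (μ y * Q y x) 0)) (by fun_prop) ?_
  exact fun μ => ⟨mem_Ici.2 (le_max_right _ _), mem_Ici.2 (le_max_right _ _)⟩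

lemma edgeWeight_concave (hΛ : AdmissibleMean Λ) (hQ : ∀ x y, 0 ≤ Q x y) {μ ν : X → ℝ}
    (hμ : ∀ x, 0 ≤ μ x) (hν : ∀ x, 0 ≤ ν x) {θ : ℝ} (h0 : 0 ≤ θ) (h1 : θ ≤ 1) (x y : X) :
    (1 - θ) * edgeWeight Λ Q μ x y + θ * edgeWeight Λ Q ν x y ≤
      edgeWeight Λ Q (fun z => (1 - θ) * μ z + θ * ν z) x y := by
  have h1' := sub_nonneg.2 h1
  rw [edgeWeight_eq hQ hμ, edgeWeight_eq hQ hν, edgeWeight_eq hQ (fun z =>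
    add_nonneg (mul_nonneg h1' (hμ z)) (mul_nonneg h0 (hν z)))]
  have h := hΛ.concave.2 (x := (μ x * Q x y, μ y * Q y x)) (y := (ν x * Q x y, ν y * Q y x))
    ⟨mul_nonneg (hμ x) (hQ x y), mul_nonneg (hμ y) (hQ y x)⟩
    ⟨mul_nonneg (hν x) (hQ x y), mul_nonneg (hν y) (hQ y x)⟩ h1' h0 (by ring)
  simp only [smul_eq_mul, Prod.fst_add, Prod.smul_fst, Prod.snd_add, Prod.smul_snd] at h
  refine h.trans_eq ?_
  congr 1 <;> ring

end EdgeWeight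

section Hamiltonian

variable {X : Type*} [Fintype X]

lemma isProb_convexComb {μ ν : X → ℝ} (hμ : IsProb μ) (hν : IsProb ν) {θ : ℝ} (h0 : 0 ≤ θ)
    (h1 : θ ≤ 1) : IsProb (fun x => (1 - θ) * μ x + θ * ν x) := by
  refine ⟨fun x => ?_, ?_⟩
  · have := mul_nonneg (sub_nonneg.2 h1) (hμ.1 x)
    have := mul_nonneg h0 (hν.1 x)
    linarith
  · rw [Finset.sum_add_distrib, ← Finset.mul_sum, ← Finset.mul_sum, hμ.2, hν.2]
    ring

/-- The Hamiltonian `⟨a, μ⟩ + ½‖∇b‖²_μ`, extended continuously to all functions `μ`. -/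
noncomputable def ham (Λ : ℝ → ℝ → ℝ) (Q : X → X → ℝ) (a b μ : X → ℝ) : ℝ :=
  dotp a μ + (1 / 4) * ∑ x, ∑ y, edgeWeight Λ Q μ x y * (b y - b x) ^ 2

/-- The Dirichlet energy of a function. -/
noncomputable def energy (Q : X → X → ℝ) (pm b : X → ℝ) : ℝ :=
  (1 / 2) * ∑ x, ∑ y, pm x * Q x y * (b y - b x) ^ 2

variable {Λ : ℝ → ℝ → ℝ} {Q : X → X → ℝ} {pm : X → ℝ}

lemma continuous_ham (hΛ : AdmissibleMean Λ) {Y : Type*} [TopologicalSpace Y]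
    {a b μ : Y → X → ℝ} (ha : Continuous a) (hb : Continuous b) (hμ : Continuous μ) :
    Continuous fun y => ham Λ Q (a y) (b y) (μ y) := by
  have hw : ∀ x z, Continuous fun y => edgeWeight Λ Q (μ y) x z := fun x z =>
    (continuous_edgeWeight hΛ x z).comp hμ
  unfold ham dotp
  fun_prop

lemma ham_eq (hQ : ∀ x y, 0 ≤ Q x y) {μ : X → ℝ} (hμ : ∀ x, 0 ≤ μ x) (a b : X → ℝ) :
    ham Λ Q a b μ = dotp a μ + (1 / 2) * gradSq Λ Q μ b := by
  simp only [ham, gradSq, edgeWeight_eq hQ hμ]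
  ring

lemma edgeWeight_stationary (hΛ : AdmissibleMean Λ) (hMT : IsMarkovTriple Q pm) (x y : X) :
    edgeWeight Λ Q pm x y = pm x * Q x y := by
  obtain ⟨hQ, -, -, hp, -, hrev⟩ := hMT
  rw [edgeWeight_eq hQ hp.1, ← hrev x y, mean_self hΛ (mul_nonneg (hp.1 x) (hQ x y))]

lemma ham_concave (hΛ : AdmissibleMean Λ) (hQ : ∀ x y, 0 ≤ Q x y) {μ ν : X → ℝ}
    (hμ : ∀ x, 0 ≤ μ x) (hν : ∀ x, 0 ≤ ν x) {θ : ℝ} (h0 : 0 ≤ θ) (h1 : θ ≤ 1) (a b : X → ℝ) :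
    (1 - θ) * ham Λ Q a b μ + θ * ham Λ Q a b ν ≤
      ham Λ Q a b (fun z => (1 - θ) * μ z + θ * ν z) := by
  have hd : dotp a (fun z => (1 - θ) * μ z + θ * ν z) = (1 - θ) * dotp a μ + θ * dotp a ν := by
    simp only [dotp, Finset.mul_sum, ← Finset.sum_add_distrib]
    exact Finset.sum_congr rfl fun x _ => by ring
  have hs : (1 - θ) * ∑ x, ∑ y, edgeWeight Λ Q μ x y * (b y - b x) ^ 2 +
      θ * ∑ x, ∑ y, edgeWeight Λ Q ν x y * (b y - b x) ^ 2 ≤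
      ∑ x, ∑ y, edgeWeight Λ Q (fun z => (1 - θ) * μ z + θ * ν z) x y * (b y - b x) ^ 2 := by
    simp only [Finset.mul_sum, ← Finset.sum_add_distrib]
    refine Finset.sum_le_sum fun x _ => Finset.sum_le_sum fun y _ => ?_
    have := mul_le_mul_of_nonneg_right (edgeWeight_concave hΛ hQ hμ hν h0 h1 x y)
      (sq_nonneg (b y - b x))
    linarith
  simp only [ham, hd]
  linarith

lemma ham_convex (hΛ : AdmissibleMean Λ) (μ a₁ a₂ b₁ b₂ : X → ℝ) {s t : ℝ} (hs : 0 ≤ s)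
    (ht : 0 ≤ t) (hst : s + t = 1) :
    ham Λ Q (s • a₁ + t • a₂) (s • b₁ + t • b₂) μ ≤
      s * ham Λ Q a₁ b₁ μ + t * ham Λ Q a₂ b₂ μ := by
  have hd : dotp (s • a₁ + t • a₂) μ = s * dotp a₁ μ + t * dotp a₂ μ := by
    simp only [dotp, Finset.mul_sum, ← Finset.sum_add_distrib, Pi.add_apply, Pi.smul_apply,
      smul_eq_mul]
    exact Finset.sum_congr rfl fun x _ => by ring
  have hq : ∑ x, ∑ y, edgeWeight Λ Q μ x y * ((s • b₁ + t • b₂) y - (s • b₁ + t • b₂) x) ^ 2 ≤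
      s * ∑ x, ∑ y, edgeWeight Λ Q μ x y * (b₁ y - b₁ x) ^ 2 +
      t * ∑ x, ∑ y, edgeWeight Λ Q μ x y * (b₂ y - b₂ x) ^ 2 := by
    simp only [Finset.mul_sum, ← Finset.sum_add_distrib, Pi.add_apply, Pi.smul_apply, smul_eq_mul]
    refine Finset.sum_le_sum fun x _ => Finset.sum_le_sum fun y _ => ?_
    have hw := edgeWeight_nonneg (Q := Q) hΛ μ x y
    obtain rfl : t = 1 - s := by linarith
    have : 0 ≤ edgeWeight Λ Q μ x y * (s * (1 - s) * ((b₁ y - b₁ x) - (b₂ y - b₂ x)) ^ 2) := by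
      positivity
    nlinarith
  simp only [ham, hd]
  linarith

lemma ham_stationary (hΛ : AdmissibleMean Λ) (hMT : IsMarkovTriple Q pm) (a b : X → ℝ) :
    ham Λ Q a b pm = dotp a pm + (1 / 2) * energy Q pm b := by
  simp only [ham, energy, edgeWeight_stationary hΛ hMT]
  ring

/-- Differences of a function are controlled by its Dirichlet energy. -/
lemma exists_sq_sub_le_energy (hMT : IsMarkovTriple Q pm) (x y : X) :
    ∃ C : ℝ, 0 ≤ C ∧ ∀ b : X → ℝ, (b y - b x) ^ 2 ≤ C * energy Q pm b := by
  obtain ⟨hQ, -, hirr, hp, hpos, -⟩ := hMT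
  have hterm : ∀ b : X → ℝ, ∀ u v, pm u * Q u v * (b v - b u) ^ 2 ≤ 2 * energy Q pm b := by
    intro b u v
    have hnn : ∀ u v, 0 ≤ pm u * Q u v * (b v - b u) ^ 2 := fun u v =>
      mul_nonneg (mul_nonneg (hp.1 u) (hQ u v)) (sq_nonneg _)
    have h1 := Finset.single_le_sum (f := fun v => pm u * Q u v * (b v - b u) ^ 2)
      (fun v _ => hnn u v) (Finset.mem_univ v)
    have h2 := Finset.single_le_sum (f := fun u => ∑ v, pm u * Q u v * (b v - b u) ^ 2)
      (fun u _ => Finset.sum_nonneg fun v _ => hnn u v) (Finset.mem_univ u)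
    simp only [energy] at *
    linarith
  induction hirr x y with
  | refl => exact ⟨0, le_rfl, fun b => by simp⟩
  | @tail u v _ huv ih =>
    obtain ⟨C, hC, h⟩ := ih
    have hk : 0 < pm u * Q u v := mul_pos (hpos u) huv
    refine ⟨2 * C + 4 / (pm u * Q u v), by positivity, fun b => ?_⟩
    have h1 : (b v - b u) ^ 2 ≤ 2 / (pm u * Q u v) * energy Q pm b := by
      rw [div_mul_eq_mul_div, le_div_iff₀ hk]
      linarith [hterm b u v]
    have h2 := h b
    have h3 : 4 / (pm u * Q u v) = 2 * (2 / (pm u * Q u v)) := by ring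
    rw [h3]
    nlinarith [sq_nonneg ((b v - b u) - (b u - b x))]

lemma energy_nonneg (hMT : IsMarkovTriple Q pm) (b : X → ℝ) : 0 ≤ energy Q pm b :=
  mul_nonneg (by norm_num) (Finset.sum_nonneg fun x _ => Finset.sum_nonneg fun y _ =>
    mul_nonneg (mul_nonneg (hMT.2.2.2.1.1 x) (hMT.1 x y)) (sq_nonneg _))

/-- A Poincaré inequality: differences of averages are controlled by the Dirichlet energy. -/
lemma exists_poincare (hMT : IsMarkovTriple Q pm) :
    ∃ C : ℝ, 0 < C ∧ ∀ b μ ν : X → ℝ, IsProb μ → IsProb ν →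
      (dotp b μ - dotp b ν) ^ 2 ≤ C * energy Q pm b := by
  choose C hC0 hC using exists_sq_sub_le_energy hMT
  set D : ℝ := 1 + ∑ x, ∑ y, C x y with hD
  have hDpos : 0 < D := by
    have : 0 ≤ ∑ x, ∑ y, C x y := Finset.sum_nonneg fun x _ => Finset.sum_nonneg fun y _ => hC0 x y
    linarith
  have hle : ∀ b : X → ℝ, ∀ x y, (b y - b x) ^ 2 ≤ D * energy Q pm b := by
    intro b x y
    refine (hC x y b).trans (mul_le_mul_of_nonneg_right ?_ (energy_nonneg hMT b))
    have h1 := Finset.single_le_sum (f := fun v => C x v)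
      (fun v _ => hC0 x v) (Finset.mem_univ y)
    have h2 := Finset.single_le_sum (f := fun u => ∑ v, C u v)
      (fun u _ => Finset.sum_nonneg fun v _ => hC0 u v) (Finset.mem_univ x)
    linarith
  refine ⟨4 * D, by positivity, fun b μ ν hμ hν => ?_⟩
  have hne : Nonempty X := by
    by_contra h
    rw [not_nonempty_iff] at h
    simpa using hμ.2
  obtain ⟨z⟩ := hne
  set A := Real.sqrt (D * energy Q pm b) with hA
  have hab : ∀ x, |b x - b z| ≤ A := fun x => Real.abs_le_sqrt (hle b z x)
  have key : ∀ μ : X → ℝ, IsProb μ → |dotp b μ - b z| ≤ A := by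
    intro μ hμ
    have h1 : dotp b μ - b z = ∑ x, (b x - b z) * μ x := by
      simp only [dotp, sub_mul, Finset.sum_sub_distrib, ← Finset.mul_sum, hμ.2, mul_one]
    rw [h1]
    calc |∑ x, (b x - b z) * μ x| ≤ ∑ x, |(b x - b z) * μ x| := Finset.abs_sum_le_sum_abs _ _
      _ ≤ ∑ x, A * μ x := Finset.sum_le_sum fun x _ => by
          rw [abs_mul, abs_of_nonneg (hμ.1 x)]
          exact mul_le_mul_of_nonneg_right (hab x) (hμ.1 x)
      _ = A := by rw [← Finset.mul_sum, hμ.2, mul_one]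
  have h2 : |dotp b μ - dotp b ν| ≤ 2 * A := by
    have := abs_sub_le (dotp b μ) (b z) (dotp b ν)
    have h3 := key μ hμ
    have h4 := key ν hν
    rw [abs_sub_comm] at h4
    linarith
  calc (dotp b μ - dotp b ν) ^ 2 = |dotp b μ - dotp b ν| ^ 2 := (sq_abs _).symm
    _ ≤ (2 * A) ^ 2 := by gcongr
    _ = 4 * D * energy Q pm b := by
      rw [mul_pow, hA, Real.sq_sqrt (mul_nonneg hDpos.le (energy_nonneg hMT b))]; ring

/-- The amount `ε t²(1-t)²` of stationary mass mixed in at time `t`. -/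
def bump (ε t : ℝ) : ℝ := ε * (t ^ 2 * (1 - t) ^ 2)

lemma bump_nonneg {ε : ℝ} (hε : 0 ≤ ε) (t : ℝ) : 0 ≤ bump ε t := by
  unfold bump; positivity

lemma bump_le {ε t : ℝ} (hε : 0 ≤ ε) (ht : t ∈ Icc (0 : ℝ) 1) : bump ε t ≤ ε := by
  obtain ⟨h0, h1⟩ := ht
  have h : t * (1 - t) ≤ 1 := by nlinarith
  have h' : 0 ≤ t * (1 - t) := mul_nonneg h0 (by linarith)
  unfold bump
  nlinarith [mul_le_one₀ h h' h]

lemma bump_pos {ε t : ℝ} (hε : 0 < ε) (ht : t ∈ Ioo (0 : ℝ) 1) : 0 < bump ε t := by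
  have h1 := ht.1
  have h2 : 0 < 1 - t := by linarith [ht.2]
  unfold bump; positivity

/-- The derivative of `bump ε`. -/
def bumpDeriv (ε t : ℝ) : ℝ := ε * (2 * (t * (1 - t)) * (1 - 2 * t))

lemma hasDerivAt_bump (ε t : ℝ) : HasDerivAt (bump ε) (bumpDeriv ε t) t := by
  have h := (((hasDerivAt_id t).pow 2).mul ((((hasDerivAt_const t (1 : ℝ)).sub
    (hasDerivAt_id t))).pow 2)).const_mul ε
  convert! h using 1
  simp only [bumpDeriv, Pi.pow_apply, Pi.sub_apply, id, Nat.cast_ofNat]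
  ring

lemma bump_absorb {C ε t E Δ : ℝ} (hC : 0 < C) (hε : 0 ≤ ε) (ht : t ∈ Icc (0 : ℝ) 1)
    (h : Δ ^ 2 ≤ C * E) :
    0 ≤ bumpDeriv ε t * Δ + (1 / 2) * bump ε t * E + 2 * C * ε := by
  obtain ⟨h0, h1⟩ := ht
  have hsq : (1 - 2 * t) ^ 2 ≤ 1 := by nlinarith
  have h2 : 0 ≤ ε / (2 * C) * (t * (1 - t) * Δ + 2 * C * (1 - 2 * t)) ^ 2 := by positivity
  have h3 : ε / (2 * C) * (t * (1 - t) * Δ + 2 * C * (1 - 2 * t)) ^ 2 =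
      bumpDeriv ε t * Δ + (1 / 2) * bump ε t * (Δ ^ 2 / C) + 2 * C * ε * (1 - 2 * t) ^ 2 := by
    unfold bump bumpDeriv; field_simp; ring
  have h4 : Δ ^ 2 / C ≤ E := by rw [div_le_iff₀ hC]; linarith
  have h5 := mul_le_mul_of_nonneg_left h4 (mul_nonneg (by norm_num : (0 : ℝ) ≤ 1 / 2)
    (bump_nonneg hε t))
  have h6 := mul_le_mul_of_nonneg_left hsq (mul_nonneg (mul_nonneg zero_le_two hC.le) hε)
  linarith

/-- Mixing in stationary mass changes the Hamiltonian by a total derivative, up to a small error. -/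
lemma ham_mix_ge (hΛ : AdmissibleMean Λ) (hMT : IsMarkovTriple Q pm) {C : ℝ} (hC : 0 < C)
    (hP : ∀ b μ ν : X → ℝ, IsProb μ → IsProb ν → (dotp b μ - dotp b ν) ^ 2 ≤ C * energy Q pm b)
    {ε t : ℝ} (h0 : 0 ≤ ε) (h1 : ε ≤ 1) (ht : t ∈ Icc (0 : ℝ) 1) {μ : X → ℝ} (hμ : IsProb μ)
    (a b : X → ℝ) :
    ham Λ Q (fun x => (1 - bump ε t) * a x - bumpDeriv ε t * b x)
        (fun x => (1 - bump ε t) * b x) μ +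
      (bump ε t * dotp a pm + bumpDeriv ε t * dotp b pm) - 2 * C * ε ≤
    ham Λ Q a b (fun x => (1 - bump ε t) * μ x + bump ε t * pm x) := by
  have hθ0 := bump_nonneg h0 t
  have hθ1 := (bump_le h0 ht).trans h1
  have hab := bump_absorb hC h0 ht (hP b μ pm hμ hMT.2.2.2.1)
  have hc := ham_concave hΛ hMT.1 hμ.1 hMT.2.2.2.1.1 hθ0 hθ1 a b
  rw [ham_stationary hΛ hMT] at hc
  generalize bump ε t = θ at *
  generalize bumpDeriv ε t = θ' at *
  refine le_trans ?_ hc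
  have hd : dotp (fun x => (1 - θ) * a x - θ' * b x) μ = (1 - θ) * dotp a μ - θ' * dotp b μ := by
    simp only [dotp, Finset.mul_sum, ← Finset.sum_sub_distrib]
    exact Finset.sum_congr rfl fun x _ => by ring
  set S := ∑ x, ∑ y, edgeWeight Λ Q μ x y * (b y - b x) ^ 2 with hS
  have hS0 : 0 ≤ S := Finset.sum_nonneg fun x _ => Finset.sum_nonneg fun y _ =>
    mul_nonneg (edgeWeight_nonneg hΛ μ x y) (sq_nonneg _)
  have hs : ∑ x, ∑ y, edgeWeight Λ Q μ x y * ((1 - θ) * b y - (1 - θ) * b x) ^ 2 =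
      (1 - θ) ^ 2 * S := by
    simp only [hS, Finset.mul_sum]
    exact Finset.sum_congr rfl fun x _ => Finset.sum_congr rfl fun y _ => by ring
  simp only [ham, hd, hs, ← hS]
  have : 0 ≤ θ * (1 - θ) * S := mul_nonneg (mul_nonneg hθ0 (sub_nonneg.2 hθ1)) hS0
  nlinarith

end Hamiltonian

section Minimax

/-- Closed convex bounded subsets of a Hilbert space are weakly compact. -/
lemma isCompact_toWeakSpace_image {E : Type*} [NormedAddCommGroup E] [InnerProductSpace ℝ E]
    [CompleteSpace E] {N : Set E} (hconv : Convex ℝ N) (hcl : IsClosed N)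
    (hb : Bornology.IsBounded N) : IsCompact (toWeakSpace ℝ E '' N) := by
  have hclosed : closure (toWeakSpace ℝ E '' N) = toWeakSpace ℝ E '' N := by
    rw [← hconv.toWeakSpace_closure ℝ, hcl.closure_eq]
  rw [← hclosed]
  refine NormedSpace.isCompact_closure_of_isBounded ℝ E _ ?_ ?_
  · rwa [preimage_image_eq _ (toWeakSpace ℝ E).injective]
  · rintro ψ -
    let ℓ : StrongDual ℝ E := (WeakDual.toStrongDual ψ).comp
      (InnerProductSpace.toDual ℝ E).toContinuousLinearEquiv.toContinuousLinearMap
    refine ⟨toWeakSpace ℝ E ((InnerProductSpace.toDual ℝ E).symm ℓ), ?_⟩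
    refine DFunLike.ext _ _ fun f => ?_
    obtain ⟨y, rfl⟩ := (InnerProductSpace.toDual ℝ E).surjective f
    change InnerProductSpace.toDual ℝ E y ((InnerProductSpace.toDual ℝ E).symm ℓ) = ℓ y
    rw [InnerProductSpace.toDual_apply_apply, real_inner_comm,
      InnerProductSpace.toDual_symm_apply]

lemma exists_forall_le_of_isCompact {E : Type*} [AddCommGroup E] [Module ℝ E]
    [TopologicalSpace E] [IsTopologicalAddGroup E] [ContinuousSMul ℝ E]
    {P : Type*} [AddCommGroup P] [Module ℝ P] {N : Set E} (hN : IsCompact N)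
    (hne : N.Nonempty) (hcN : Convex ℝ N) {L : P → E → ℝ}
    (hconv : ∀ p, ConvexOn ℝ N (L p)) (hlsc : ∀ p, LowerSemicontinuousOn (L p) N)
    (hconc : ∀ n ∈ N, ConcaveOn ℝ univ fun p => L p n) {c : ℝ}
    (h : ∀ p, ∃ n ∈ N, L p n ≤ c) : ∃ n ∈ N, ∀ p, L p n ≤ c := by
  classical
  by_contra! hcon
  obtain ⟨s, hs⟩ : ∃ s : Finset P, ∀ n ∈ N, ∃ p ∈ s, c < L p n := by
    choose! p hp using hcon
    have hnb : ∀ n ∈ N, {n' | c < L (p n) n'} ∈ 𝓝[N] n := fun n hn =>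
      hlsc (p n) n hn c (hp n hn)
    obtain ⟨t, htN, ht⟩ := hN.elim_nhdsWithin_subcover _ hnb
    refine ⟨t.image p, fun n hn => ?_⟩
    obtain ⟨n', hn', h'⟩ := mem_iUnion₂.1 (ht hn)
    exact ⟨p n', Finset.mem_image_of_mem _ hn', h'⟩
  let comb : (s → ℝ) →ₗ[ℝ] P := Fintype.linearCombination ℝ fun i : s => (i : P)
  have hcomb : ∀ n ∈ N, ConcaveOn ℝ univ fun y : s → ℝ => L (comb y) n := fun n hn =>
    (hconc n hn).comp_linearMap comb
  obtain ⟨y₀, -, hy₀⟩ := Sion.exists_lt_iInf_of_lt_iInf_of_finite (f := fun n y => L (comb y) n)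
    (X := N) (Y := (univ : Set (s → ℝ))) (s := range fun i : s => Pi.single i (1 : ℝ)) (t := c)
    hne hN (fun y _ => hlsc _) (fun y _ => (hconv _).quasiconvexOn) convex_univ
    (fun n hn => ((hcomb n hn).continuousOn isOpen_univ).upperSemicontinuousOn)
    (fun n hn => (hcomb n hn).quasiconcaveOn)
    hcN (finite_range _) (subset_univ _) (fun n hn => by
      obtain ⟨p, hp, hlt⟩ := hs n hn
      refine ⟨_, ⟨⟨p, hp⟩, rfl⟩, ?_⟩
      simpa [comb, Fintype.linearCombination_apply_single] using hlt)
  obtain ⟨n, hn, hle⟩ := h (comb y₀)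
  exact absurd (hy₀ n hn) (not_lt.2 hle)

/-- A minimax theorem on closed convex bounded subsets of a Hilbert space. -/
lemma exists_forall_le_of_isBounded {E : Type*} [NormedAddCommGroup E] [InnerProductSpace ℝ E]
    [CompleteSpace E] {P : Type*} [AddCommGroup P] [Module ℝ P] {N : Set E} (hcl : IsClosed N)
    (hb : Bornology.IsBounded N) (hne : N.Nonempty) (hcN : Convex ℝ N) {L : P → E → ℝ}
    (hconv : ∀ p, ConvexOn ℝ N (L p)) (hlsc : ∀ p c, IsClosed {n ∈ N | L p n ≤ c})
    (hconc : ∀ n ∈ N, ConcaveOn ℝ univ fun p => L p n) {c : ℝ}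
    (h : ∀ p, ∃ n ∈ N, L p n ≤ c) : ∃ n ∈ N, ∀ p, L p n ≤ c := by
  let e := toWeakSpace ℝ E
  have hmem : ∀ n : WeakSpace ℝ E, n ∈ e '' N ↔ e.symm n ∈ N := fun n => by
    rw [e.image_eq_preimage_symm]; rfl
  obtain ⟨n, hn, hle⟩ := exists_forall_le_of_isCompact (L := fun p (n : WeakSpace ℝ E) =>
    L p (e.symm n)) (c := c) (isCompact_toWeakSpace_image hcN hcl hb) (hne.image e)
    (hcN.linear_image e.toLinearMap) (fun p => by
      have h1 := (hconv p).comp_linearMap e.symm.toLinearMap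
      have h2 : e.symm.toLinearMap ⁻¹' N = e '' N := by ext n; exact (hmem n).symm
      rwa [h2] at h1) (fun p => by
      rw [lowerSemicontinuousOn_iff_preimage_Iic]
      intro c
      refine ⟨e '' {n ∈ N | L p n ≤ c}, ?_, ?_⟩
      · have := ((hconv p).convex_le c).toWeakSpace_closure ℝ
        rw [(hlsc p c).closure_eq] at this
        rw [this]
        exact isClosed_closure
      · ext n
        have h2 : n ∈ e '' {n ∈ N | L p n ≤ c} ↔ e.symm n ∈ N ∧ L p (e.symm n) ≤ c := by
          rw [e.image_eq_preimage_symm]; rfl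
        exact ⟨fun h => ⟨h.1, h2.2 ⟨(hmem n).1 h.1, h.2⟩⟩, fun h => ⟨h.1, (h2.1 h.2).2⟩⟩)
      (fun n hn => hconc _ ((hmem n).1 hn)) (fun p => by
      obtain ⟨n, hn, hle⟩ := h p
      exact ⟨e n, mem_image_of_mem _ hn, by simpa using hle⟩)
  exact ⟨e.symm n, (hmem n).1 hn, hle⟩

end Minimax

section IntegralMinimax

/-- Lebesgue measure on the unit interval. -/
noncomputable abbrev unitVol : Measure ℝ := volume.restrict (Ioc 0 1)

lemma ae_unitVol_mem : ∀ᵐ t ∂unitVol, t ∈ Ioc (0 : ℝ) 1 := ae_restrict_mem measurableSet_Ioc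

lemma intervalIntegrable_iff_unitVol {f : ℝ → ℝ} :
    IntervalIntegrable f volume 0 1 ↔ Integrable f unitVol :=
  intervalIntegrable_iff_integrableOn_Ioc_of_le zero_le_one

variable {V : Type*} [NormedAddCommGroup V] {K : Set V}

lemma exists_bound_on_unit {G : ℝ → V → ℝ} (hG : Continuous (Function.uncurry G))
    (hK : IsCompact K) : ∃ M, ∀ t ∈ Ioc (0 : ℝ) 1, ∀ v ∈ K, ‖G t v‖ ≤ M := by
  obtain ⟨M, hM⟩ := (isCompact_Icc.prod hK).exists_bound_of_continuousOn
    (f := Function.uncurry G) (s := Icc (0 : ℝ) 1 ×ˢ K) hG.continuousOn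
  exact ⟨M, fun t ht v hv => hM (t, v) ⟨Ioc_subset_Icc_self ht, hv⟩⟩

lemma integrable_comp {G : ℝ → V → ℝ} (hG : Continuous (Function.uncurry G))
    (hK : IsCompact K) {n : ℝ → V} (hn : AEStronglyMeasurable n unitVol)
    (hnK : ∀ᵐ t ∂unitVol, n t ∈ K) : Integrable (fun t => G t (n t)) unitVol := by
  obtain ⟨M, hM⟩ := exists_bound_on_unit hG hK
  refine Integrable.of_bound (C := M)
    (hG.comp_aestronglyMeasurable (aestronglyMeasurable_id.prodMk hn)) ?_
  filter_upwards [hnK, ae_unitVol_mem] with t h1 h2 using hM t h2 _ h1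

lemma exists_subseq_tendsto_integral {G : ℝ → V → ℝ} (hG : Continuous (Function.uncurry G))
    (hK : IsCompact K) {u : ℕ → Lp V 2 unitVol} {n : Lp V 2 unitVol}
    (hu : ∀ k, ∀ᵐ t ∂unitVol, u k t ∈ K) (hlim : Tendsto u atTop (𝓝 n)) :
    (∀ᵐ t ∂unitVol, n t ∈ K) ∧ ∃ φ : ℕ → ℕ,
      Tendsto (fun k => ∫ t, G t (u (φ k) t) ∂unitVol) atTop (𝓝 (∫ t, G t (n t) ∂unitVol)) := by
  obtain ⟨φ, -, hφ⟩ := (tendstoInMeasure_of_tendsto_Lp hlim).exists_seq_tendsto_ae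
  have hall := ae_all_iff.2 hu
  refine ⟨?_, φ, ?_⟩
  · filter_upwards [hφ, hall] with t ht h
    exact hK.isClosed.mem_of_tendsto ht (Eventually.of_forall fun k => h _)
  · obtain ⟨M, hM⟩ := exists_bound_on_unit hG hK
    refine tendsto_integral_of_dominated_convergence (fun _ => M)
      (fun k => (integrable_comp hG hK (Lp.aestronglyMeasurable _)
        (hu (φ k))).aestronglyMeasurable) (integrable_const _) (fun k => ?_) ?_
    · filter_upwards [hu (φ k), ae_unitVol_mem] with t h1 h2 using hM t h2 _ h1
    · filter_upwards [hφ] with t ht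
      exact (hG.tendsto (t, n t)).comp (tendsto_const_nhds.prodMk_nhds ht)

variable [InnerProductSpace ℝ V] [FiniteDimensional ℝ V] [MeasurableSpace V] [BorelSpace V]

/-- Pointwise maximisers can be chosen piecewise constant in time, up to a small error. -/
lemma exists_near_maximiser {G : ℝ → V → ℝ} (hG : Continuous (Function.uncurry G))
    (hK : IsCompact K) (hne : K.Nonempty) {η : ℝ} (hη : 0 < η) :
    ∃ n : ℝ → V, StronglyMeasurable n ∧ (∀ t, n t ∈ K) ∧
      ∫ t, sSup (G t '' K) ∂unitVol - η ≤ ∫ t, G t (n t) ∂unitVol := by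
  have hmax : ∀ t, ∃ v ∈ K, sSup (G t '' K) = G t v ∧ ∀ w ∈ K, G t w ≤ G t v := fun t =>
    hK.exists_sSup_image_eq_and_ge hne (hG.comp (Continuous.prodMk_right t)).continuousOn
  choose v hvK hvs hvm using hmax
  have huc := (isCompact_Icc.prod hK).uniformContinuousOn_of_continuous
    (f := Function.uncurry G) (s := Icc (0 : ℝ) 1 ×ˢ K) hG.continuousOn
  obtain ⟨δ, hδ, huc⟩ := Metric.uniformContinuousOn_iff.1 huc (η / 2) (by positivity)
  obtain ⟨m, hm⟩ := exists_nat_one_div_lt hδ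
  set r : ℤ → ℝ := fun k => k / ((m : ℝ) + 1) with hr
  have hm0 : (0 : ℝ) < (m : ℝ) + 1 := by positivity
  refine ⟨fun t => v (r ⌊((m : ℝ) + 1) * t⌋), ?_, fun t => hvK _, ?_⟩
  · have h1 : Measurable fun k : ℤ => v (r k) := measurable_of_countable _
    exact (h1.comp (Int.measurable_floor.comp (measurable_const_mul _))).stronglyMeasurable
  have hmeas : AEStronglyMeasurable (fun t => v (r ⌊((m : ℝ) + 1) * t⌋)) unitVol := by
    have h1 : Measurable fun k : ℤ => v (r k) := measurable_of_countable _
    exact (h1.comp (Int.measurable_floor.comp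
      (measurable_const_mul _))).stronglyMeasurable.aestronglyMeasurable
  have hsc : Continuous fun t => sSup (G t '' K) := hK.continuous_sSup hG
  have hsi : Integrable (fun t => sSup (G t '' K)) unitVol :=
    intervalIntegrable_iff_unitVol.1 (hsc.intervalIntegrable 0 1)
  have hle : ∫ t, (sSup (G t '' K) - η) ∂unitVol ≤
      ∫ t, G t (v (r ⌊((m : ℝ) + 1) * t⌋)) ∂unitVol := by
    refine integral_mono_ae (hsi.sub (integrable_const _))
      (integrable_comp hG hK hmeas (Eventually.of_forall fun t => hvK _)) ?_
    filter_upwards [ae_unitVol_mem] with t ht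
    set s := r ⌊((m : ℝ) + 1) * t⌋ with hs
    have hfl := Int.floor_le (((m : ℝ) + 1) * t)
    have hfu := Int.lt_floor_add_one (((m : ℝ) + 1) * t)
    have hst : s ≤ t := by rw [hs, hr, div_le_iff₀ hm0]; linarith
    have hts : t - s < 1 / ((m : ℝ) + 1) := by
      rw [hs, hr, sub_lt_iff_lt_add, ← add_div, lt_div_iff₀ hm0]; linarith
    have hs0 : 0 ≤ s := by
      rw [hs, hr]
      refine div_nonneg ?_ hm0.le
      exact_mod_cast Int.floor_nonneg.2 (mul_nonneg hm0.le ht.1.le)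
    have hsI : s ∈ Icc (0 : ℝ) 1 := ⟨hs0, hst.trans ht.2⟩
    have hd : ∀ w ∈ K, dist (G s w) (G t w) < η / 2 := fun w hw => by
      refine huc (s, w) ⟨hsI, hw⟩ (t, w) ⟨Ioc_subset_Icc_self ht, hw⟩ ?_
      rw [Prod.dist_eq, dist_self, max_eq_left dist_nonneg, Real.dist_eq, abs_sub_comm,
        abs_of_nonneg (sub_nonneg.2 hst)]
      exact hts.trans hm
    have h1 := abs_lt.1 (hd (v s) (hvK s))
    have h2 := abs_lt.1 (hd (v t) (hvK t))
    have h3 := hvm s (v t) (hvK t)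
    rw [hvs t]
    linarith [h1.2, h2.1]
  rw [integral_sub hsi (integrable_const _)] at hle
  simpa using hle

/-- A minimax theorem for integral functionals. -/
theorem exists_forall_sub_integral_le (hK : IsCompact K) (hne : K.Nonempty) (hKc : Convex ℝ K)
    {P : Type*} [AddCommGroup P] [Module ℝ P] (d : P →ₗ[ℝ] ℝ) {G : P → ℝ → V → ℝ}
    (hG : ∀ p, Continuous (Function.uncurry (G p)))
    (hconc : ∀ p, ∀ t ∈ Ioc (0 : ℝ) 1, ConcaveOn ℝ K (G p t))
    (hconv : ∀ t, ∀ v, ConvexOn ℝ univ fun p => G p t v) {c c' : ℝ} (hc : c < c')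
    (h : ∀ p, d p - ∫ t, sSup (G p t '' K) ∂unitVol ≤ c) :
    ∃ n : ℝ → V, AEStronglyMeasurable n unitVol ∧ (∀ᵐ t ∂unitVol, n t ∈ K) ∧
      ∀ p, d p - ∫ t, G p t (n t) ∂unitVol ≤ c' := by
  let N : Set (Lp V 2 unitVol) := {n | ∀ᵐ t ∂unitVol, n t ∈ K}
  have hinteg : ∀ p, ∀ n ∈ N, Integrable (fun t => G p t (n t)) unitVol := fun p n hn =>
    integrable_comp (hG p) hK (Lp.aestronglyMeasurable _) hn
  obtain ⟨R, hR⟩ := hK.isBounded.exists_norm_le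
  have hmemN : ∀ n : ℝ → V, AEStronglyMeasurable n unitVol → (∀ᵐ t ∂unitVol, n t ∈ K) →
      ∃ f ∈ N, f =ᵐ[unitVol] n := fun n hn hnK => by
    have hL : MemLp n 2 unitVol := MemLp.of_bound hn R (hnK.mono fun t ht => hR _ ht)
    refine ⟨hL.toLp n, ?_, hL.coeFn_toLp⟩
    filter_upwards [hL.coeFn_toLp, hnK] with t h1 h2
    rwa [h1]
  have hcN : Convex ℝ N := by
    intro f hf g hg a b ha hb hab
    filter_upwards [hf, hg, Lp.coeFn_add (a • f) (b • g), Lp.coeFn_smul a f,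
      Lp.coeFn_smul b g] with t h1 h2 h3 h4 h5
    rw [h3, Pi.add_apply, h4, h5]
    exact hKc h1 h2 ha hb hab
  have hbd : Bornology.IsBounded N := by
    refine isBounded_iff_forall_norm_le.2 ⟨_, fun f hf => Lp.norm_le_of_ae_bound (C := max R 0)
      (le_max_right _ _) ((show ∀ᵐ t ∂unitVol, f t ∈ K from hf).mono fun t ht =>
        (hR _ ht).trans (le_max_left _ _))⟩
  have hneN : N.Nonempty := by
    obtain ⟨v, hv⟩ := hne
    obtain ⟨f, hf, -⟩ := hmemN (fun _ => v) aestronglyMeasurable_const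
      (Eventually.of_forall fun _ => hv)
    exact ⟨f, hf⟩
  have hclosed : ∀ p c, IsClosed {n ∈ N | d p - ∫ t, G p t (n t) ∂unitVol ≤ c} := fun p c => by
    refine IsSeqClosed.isClosed fun u n hu hlim => ?_
    obtain ⟨h1, φ, hφ⟩ := exists_subseq_tendsto_integral (hG p) hK (fun k => (hu k).1) hlim
    exact ⟨h1, le_of_tendsto (tendsto_const_nhds.sub hφ) (Eventually.of_forall fun k => (hu _).2)⟩
  have hclN : IsClosed N := by
    refine IsSeqClosed.isClosed fun u n hu hlim => ?_
    exact (exists_subseq_tendsto_integral (hG 0) hK hu hlim).1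
  obtain ⟨n, hn, hle⟩ := exists_forall_le_of_isBounded (N := N)
    (L := fun p n => d p - ∫ t, G p t (n t) ∂unitVol) (c := c') hclN hbd hneN hcN
    (fun p => by
      refine ⟨hcN, fun f hf g hg a b ha hb hab => ?_⟩
      have hle : ∫ t, (a * G p t (f t) + b * G p t (g t)) ∂unitVol ≤
          ∫ t, G p t ((a • f + b • g : Lp V 2 unitVol) t) ∂unitVol := by
        refine integral_mono_ae (((hinteg p f hf).const_mul a).add ((hinteg p g hg).const_mul b))
          (hinteg p _ (hcN hf hg ha hb hab)) ?_
        filter_upwards [hf, hg, Lp.coeFn_add (a • f) (b • g), Lp.coeFn_smul a f,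
          Lp.coeFn_smul b g, ae_unitVol_mem] with t h1 h2 h3 h4 h5 h6
        rw [h3, Pi.add_apply, h4, h5]
        exact (hconc p t h6).2 h1 h2 ha hb hab
      rw [integral_add ((hinteg p f hf).const_mul a) ((hinteg p g hg).const_mul b),
        integral_const_mul, integral_const_mul] at hle
      simp only [smul_eq_mul]
      have : d p = a * d p + b * d p := by rw [← add_mul, hab, one_mul]
      linarith) hclosed
    (fun n hn => by
      refine ⟨convex_univ, fun p _ q _ a b ha hb hab => ?_⟩
      have hle : ∫ t, G (a • p + b • q) t (n t) ∂unitVol ≤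
          ∫ t, (a * G p t (n t) + b * G q t (n t)) ∂unitVol := by
        refine integral_mono_ae (hinteg _ n hn) (((hinteg p n hn).const_mul a).add
          ((hinteg q n hn).const_mul b)) (Eventually.of_forall fun t => ?_)
        exact (hconv t (n t)).2 (mem_univ p) (mem_univ q) ha hb hab
      rw [integral_add ((hinteg p n hn).const_mul a) ((hinteg q n hn).const_mul b),
        integral_const_mul, integral_const_mul] at hle
      simp only [smul_eq_mul, map_add, map_smul]
      linarith)
    (fun p => by
      obtain ⟨n, hn, hnK, hle⟩ := exists_near_maximiser (hG p) hK hne (sub_pos.2 hc)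
      obtain ⟨f, hf, hfn⟩ := hmemN n hn.aestronglyMeasurable (Eventually.of_forall hnK)
      refine ⟨f, hf, ?_⟩
      have : ∫ t, G p t (f t) ∂unitVol = ∫ t, G p t (n t) ∂unitVol :=
        integral_congr_ae (hfn.mono fun t ht => by simp only [ht])
      simp only [this]
      linarith [h p])
  exact ⟨n, Lp.aestronglyMeasurable n, hn, hle⟩

end IntegralMinimax

section WeakDuality

/-- Integration by parts of a `C¹` function against an absolutely continuous one. -/
lemma integral_deriv_mul_primitive {f f' g m : ℝ → ℝ} {m₀ : ℝ}
    (hf' : ContinuousOn f' (Icc 0 1))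
    (hf : ∀ t ∈ Icc (0 : ℝ) 1, HasDerivWithinAt f (f' t) (Icc 0 1) t)
    (hg : Integrable g unitVol) (hm : ∀ t ∈ Icc (0 : ℝ) 1, m t = m₀ + ∫ s in (0 : ℝ)..t, g s) :
    Integrable (fun t => f' t * m t + f t * g t) unitVol ∧
      ∫ t, (f' t * m t + f t * g t) ∂unitVol = f 1 * m 1 - f 0 * m 0 := by
  have hgi : IntervalIntegrable g volume 0 1 := intervalIntegrable_iff_unitVol.2 hg
  have h01 : uIcc (0 : ℝ) 1 = Icc 0 1 := uIcc_of_le zero_le_one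
  have hprim := hgi.absolutelyContinuousOnInterval_intervalIntegral (c := 0) (by simp)
  have hprimc : ContinuousOn (fun t => ∫ s in (0 : ℝ)..t, g s) (Icc 0 1) := by
    simpa [h01] using hprim.continuousOn
  have hmc : ContinuousOn m (Icc 0 1) := (continuousOn_const.add hprimc).congr hm
  have hfc : ContinuousOn f (Icc 0 1) := fun t ht => (hf t ht).continuousWithinAt
  have hinteg : IntervalIntegrable (fun t => f' t * m t + f t * g t) volume 0 1 :=
    (ContinuousOn.intervalIntegrable (by rw [h01]; exact hf'.mul hmc)).add
      (hgi.continuousOn_mul (by rwa [h01]))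
  refine ⟨intervalIntegrable_iff_unitVol.1 hinteg, ?_⟩
  obtain ⟨M, hM⟩ := isCompact_Icc.exists_bound_of_continuousOn hf'
  have hfac : AbsolutelyContinuousOnInterval f 0 1 := by
    refine LipschitzOnWith.absolutelyContinuousOnInterval (K := M.toNNReal) ?_
    rw [h01]
    refine (convex_Icc 0 1).lipschitzOnWith_of_nnnorm_hasDerivWithin_le hf fun t ht => ?_
    rw [← NNReal.coe_le_coe, coe_nnnorm]
    exact (hM t ht).trans (Real.le_coe_toNNReal M)
  have hcac : AbsolutelyContinuousOnInterval (fun _ : ℝ => m₀) 0 1 :=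
    LipschitzOnWith.absolutelyContinuousOnInterval (K := 0) (LipschitzWith.const m₀).lipschitzOnWith
  have hIBP := hfac.integral_deriv_mul_eq_sub (hcac.add hprim)
  rw [← intervalIntegral.integral_of_le zero_le_one, hm 1 (by simp), hm 0 (by simp)]
  refine Eq.trans ?_ hIBP
  refine intervalIntegral.integral_congr_ae ?_
  filter_upwards [hgi.ae_hasDerivAt_integral, Measure.ae_ne volume (1 : ℝ)] with t ht ht1 htI
  rw [uIoc_of_le zero_le_one] at htI
  have htc : t ∈ Icc (0 : ℝ) 1 := Ioc_subset_Icc_self htI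
  have hd1 : deriv f t = f' t :=
    ((hf t htc).hasDerivAt (Icc_mem_nhds htI.1 (lt_of_le_of_ne htI.2 ht1))).deriv
  have hd2 : deriv ((fun _ : ℝ => m₀) + fun t => ∫ s in (0 : ℝ)..t, g s) t = g t :=
    ((ht (by rwa [h01]) 0 (by simp)).const_add m₀).deriv
  rw [hd1, hd2, hm t htc]
  rfl

lemma ofReal_mul_sub_le_Afun {Λ : ℝ → ℝ → ℝ} (hΛ : AdmissibleMean Λ) (s t w δ : ℝ) :
    ENNReal.ofReal (δ * w - (1 / 2) * (Λ s t * δ ^ 2)) ≤ Afun Λ s t w / 2 := by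
  unfold Afun
  split_ifs with h1 h2
  · have hp := mean_pos hΛ h1.1 h1.2
    rw [← ENNReal.ofReal_ofNat, ← ENNReal.ofReal_div_of_pos (by norm_num)]
    refine ENNReal.ofReal_le_ofReal ?_
    have h : w ^ 2 / Λ s t / 2 - (δ * w - (1 / 2) * (Λ s t * δ ^ 2)) =
        (w - Λ s t * δ) ^ 2 / Λ s t / 2 := by
      field_simp; ring
    have : 0 ≤ (w - Λ s t * δ) ^ 2 / Λ s t / 2 := by positivity
    linarith
  · obtain ⟨rfl, hs, ht⟩ := h2
    rw [ENNReal.ofReal_of_nonpos]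
    · exact zero_le
    · have := mul_nonneg (hΛ.nonneg s t hs ht) (sq_nonneg δ)
      linarith
  · simp [ENNReal.top_div]

variable {X : Type*} [Fintype X]

lemma integral_dotp_primitive {φ φ' g μ : ℝ → X → ℝ} {m₀ : X → ℝ}
    (hφ' : ∀ x, ContinuousOn (fun t => φ' t x) (Icc 0 1))
    (hφ : ∀ x, ∀ t ∈ Icc (0 : ℝ) 1,
      HasDerivWithinAt (fun s => φ s x) (φ' t x) (Icc 0 1) t)
    (hg : ∀ x, Integrable (fun t => g t x) unitVol)
    (hμ : ∀ x, ∀ t ∈ Icc (0 : ℝ) 1, μ t x = m₀ x + ∫ s in (0 : ℝ)..t, g s x) :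
    Integrable (fun t => dotp (φ' t) (μ t) + dotp (φ t) (g t)) unitVol ∧
      ∫ t, (dotp (φ' t) (μ t) + dotp (φ t) (g t)) ∂unitVol =
        dotp (φ 1) (μ 1) - dotp (φ 0) (μ 0) := by
  have h := fun x => integral_deriv_mul_primitive (hφ' x) (hφ x) (hg x) (hμ x)
  simp only [dotp, ← Finset.sum_add_distrib, ← Finset.sum_sub_distrib]
  refine ⟨integrable_finsetSum _ fun x _ => (h x).1, ?_⟩
  rw [integral_finsetSum _ fun x _ => (h x).1]
  exact Finset.sum_congr rfl fun x _ => (h x).2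

/-- Summation by parts. -/
lemma dotp_neg_div (b : X → ℝ) (V : X → X → ℝ) :
    dotp b (fun x => -((1 / 2) * ∑ y, (V x y - V y x))) =
      (1 / 2) * ∑ x, ∑ y, (b y - b x) * V x y := by
  have h : ∑ x, ∑ y, b x * V y x = ∑ x, ∑ y, b y * V x y := Finset.sum_comm
  have h1 : dotp b (fun x => -((1 / 2) * ∑ y, (V x y - V y x))) =
      (1 / 2) * (∑ x, ∑ y, b x * V y x - ∑ x, ∑ y, b x * V x y) := by
    simp only [dotp, Finset.mul_sum, ← Finset.sum_sub_distrib, ← Finset.sum_neg_distrib]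
    exact Finset.sum_congr rfl fun x _ => Finset.sum_congr rfl fun y _ => by ring
  rw [h1, h]
  simp only [← Finset.sum_sub_distrib, sub_mul]

variable {Λ : ℝ → ℝ → ℝ} {Q : X → X → ℝ} {pm : X → ℝ}

lemma ofReal_le_action (hΛ : AdmissibleMean Λ) {a b μ : X → ℝ}
    (h : dotp a μ + (1 / 2) * gradSq Λ Q μ b ≤ 0) (V : X → X → ℝ) :
    ENNReal.ofReal (dotp a μ + (1 / 2) * ∑ x, ∑ y, (b y - b x) * V x y) ≤ action Λ Q μ V / 2 := by
  have h1 : dotp a μ + (1 / 2) * ∑ x, ∑ y, (b y - b x) * V x y ≤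
      (∑ x, ∑ y, ((b y - b x) * V x y -
        (1 / 2) * (Λ (μ x * Q x y) (μ y * Q y x) * (b y - b x) ^ 2))) / 2 := by
    simp only [Finset.sum_sub_distrib, ← Finset.mul_sum]
    unfold gradSq at h
    linarith
  refine (ENNReal.ofReal_le_ofReal h1).trans ?_
  rw [ENNReal.ofReal_div_of_pos (by norm_num), ENNReal.ofReal_ofNat, action]
  refine ENNReal.div_le_div_right ?_ _
  simp only [div_eq_mul_inv, Finset.sum_mul]
  refine (Finset.le_sum_of_subadditive _ ENNReal.ofReal_zero.le
    (fun _ _ => ENNReal.ofReal_add_le) _ _).trans (Finset.sum_le_sum fun x _ => ?_)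
  refine (Finset.le_sum_of_subadditive _ ENNReal.ofReal_zero.le
    (fun _ _ => ENNReal.ofReal_add_le) _ _).trans (Finset.sum_le_sum fun y _ => ?_)
  simpa [div_eq_mul_inv] using
    ofReal_mul_sub_le_Afun hΛ (μ x * Q x y) (μ y * Q y x) (V x y) (b y - b x)

/-- Weak duality. -/
lemma ofReal_dual_le_curveAction (hΛ : AdmissibleMean Λ) {μ0 μ1 : X → ℝ} {φ : ℝ → X → ℝ}
    (hφ : IsHJ Λ Q 1 φ) {μ : ℝ → X → ℝ} {V : ℝ → X → X → ℝ} (hCE : IsCE1 μ0 μ1 μ V) :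
    ENNReal.ofReal (dotp (φ 1) μ1 - dotp (φ 0) μ0) ≤ curveAction Λ Q μ V / 2 := by
  obtain ⟨φ', hφ', hφd, hHJ⟩ := hφ
  obtain ⟨-, hV, hprob, rfl, rfl, hμ⟩ := hCE
  have hVi := fun x y => intervalIntegrable_iff_unitVol.1 (hV x y)
  set g : ℝ → X → ℝ := fun t x => -((1 / 2) * ∑ y, (V t x y - V t y x)) with hg
  have hgi : ∀ x, Integrable (fun t => g t x) unitVol := fun x =>
    ((integrable_finsetSum _ fun y _ => (hVi x y).sub (hVi y x)).const_mul _).neg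
  have hμg : ∀ x, ∀ t ∈ Icc (0 : ℝ) 1, μ t x = μ 0 x + ∫ s in (0 : ℝ)..t, g s x := by
    intro x t ht
    rw [hμ x t ht, hg, intervalIntegral.integral_neg, sub_eq_add_neg]
  obtain ⟨hinteg, heq⟩ := integral_dotp_primitive hφ' hφd hgi hμg
  rw [← heq]
  have hcurve : curveAction Λ Q μ V / 2 = ∫⁻ t, action Λ Q (μ t) (V t) / 2 ∂unitVol := by
    simp only [div_eq_mul_inv]
    rw [lintegral_mul_const' _ _ (by simp), curveAction, unitVol, restrict_Ioc_eq_restrict_Icc]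
  rw [hcurve]
  refine le_trans (b := ∫⁻ t, ENNReal.ofReal
    (dotp (φ' t) (μ t) + dotp (φ t) (g t)) ∂unitVol) ?_ ?_
  · refine (ENNReal.ofReal_le_ofReal (integral_mono hinteg hinteg.pos_part
      fun t => le_max_left _ 0)).trans ?_
    rw [ofReal_integral_eq_lintegral_ofReal hinteg.pos_part (ae_of_all _ fun t => le_max_right _ _)]
    refine lintegral_mono fun t => ?_
    simp
  · refine lintegral_mono_ae ?_
    filter_upwards [ae_unitVol_mem] with t ht
    have ht' := Ioc_subset_Icc_self ht
    rw [hg, dotp_neg_div]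
    exact ofReal_le_action hΛ (hHJ t ht' (μ t) (hprob t ht')) (V t)

lemma isHJ_zero : IsHJ Λ Q 1 (0 : ℝ → X → ℝ) := by
  refine ⟨0, fun x => continuousOn_const, fun x t _ => hasDerivWithinAt_const t _ 0, ?_⟩
  simp [dotp, gradSq]

end WeakDuality

section Subsolutions

variable {X : Type*} [Fintype X] {Λ : ℝ → ℝ → ℝ} {Q : X → X → ℝ} {pm : X → ℝ}

/-- The dual functional is bounded on subsolutions. -/
lemma exists_dual_le (hΛ : AdmissibleMean Λ) (hMT : IsMarkovTriple Q pm) {μ0 μ1 : X → ℝ}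
    (hμ0 : IsProb μ0) (hμ1 : IsProb μ1) :
    ∃ B, ∀ φ : ℝ → X → ℝ, IsHJ Λ Q 1 φ → dotp (φ 1) μ1 - dotp (φ 0) μ0 ≤ B := by
  obtain ⟨C, hC, hP⟩ := exists_poincare hMT
  have hpm := hMT.2.2.2.1
  refine ⟨40 * C, ?_⟩
  rintro φ ⟨φ', -, hφd, hHJ⟩
  set s : ℝ → ℝ := fun t => 3 * t ^ 2 - 2 * t ^ 3 with hs
  have hsd : ∀ t, HasDerivAt s (6 * (t * (1 - t))) t := fun t => by
    have h := (((hasDerivAt_id t).pow 2).const_mul 3).sub (((hasDerivAt_id t).pow 3).const_mul 2)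
    convert! h using 1
    simp only [id]; push_cast; ring
  set q : ℝ → X → ℝ := fun t x => (1 - s t) * μ0 x + s t * μ1 x with hq
  set m : ℝ → X → ℝ := fun t x => (1 - bump 1 t) * q t x + bump 1 t * pm x with hm
  set m' : ℝ → X → ℝ := fun t x => bumpDeriv 1 t * (pm x - q t x) +
    (1 - bump 1 t) * (6 * (t * (1 - t))) * (μ1 x - μ0 x) with hm'
  have hmd : ∀ t x, HasDerivAt (fun t => m t x) (m' t x) t := by
    intro t x
    have hθ := hasDerivAt_bump 1 t
    have hqd := (((hsd t).const_sub 1).mul_const (μ0 x)).add ((hsd t).mul_const (μ1 x))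
    have h := ((hθ.const_sub 1).mul hqd).add (hθ.mul_const (pm x))
    convert! h using 1
    simp only [hm', hq, Pi.add_apply]; ring
  set f : ℝ → ℝ := fun t => dotp (φ t) (m t) with hf
  have hfc : ContinuousOn f (Icc 0 1) := continuousOn_finsetSum _ fun x _ =>
    ContinuousOn.mul (fun t ht => (hφd x t ht).continuousWithinAt)
      fun t _ => (hmd t x).continuousAt.continuousWithinAt
  have hfd : ∀ t ∈ Ioo (0 : ℝ) 1,
      HasDerivAt f (dotp (φ' t) (m t) + dotp (φ t) (m' t)) t := by
    intro t ht
    simp only [dotp, ← Finset.sum_add_distrib]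
    exact HasDerivAt.fun_sum fun x _ =>
      ((hφd x t (Ioo_subset_Icc_self ht)).hasDerivAt (Icc_mem_nhds ht.1 ht.2)).mul (hmd t x)
  have hle : ∀ t ∈ Ioo (0 : ℝ) 1, dotp (φ' t) (m t) + dotp (φ t) (m' t) ≤ 40 * C := by
    intro t ht
    have htc := Ioo_subset_Icc_self ht
    have hτ0 : 0 ≤ t * (1 - t) := mul_nonneg htc.1 (by linarith [htc.2])
    have hs0 : 0 ≤ s t := by
      have : s t = t ^ 2 * (1 + 2 * (1 - t)) := by simp only [hs]; ring
      rw [this]; have := htc.2; have : 0 ≤ 1 - t := by linarith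
      positivity
    have hs1 : s t ≤ 1 := by
      have : 1 - s t = (1 - t) ^ 2 * (1 + 2 * t) := by simp only [hs]; ring
      have h2 : 0 ≤ (1 - t) ^ 2 * (1 + 2 * t) := by have := htc.1; positivity
      linarith
    have hqp : IsProb (q t) := isProb_convexComb hμ0 hμ1 hs0 hs1
    have hθ0 := bump_nonneg zero_le_one t
    have hθ1 := bump_le zero_le_one htc
    have hmp : IsProb (m t) := isProb_convexComb hqp hpm hθ0 hθ1
    have hE := energy_nonneg hMT (φ t)
    have h1 := hHJ t htc (m t) hmp
    have hconc := ham_concave hΛ hMT.1 hqp.1 hpm.1 hθ0 hθ1 (0 : X → ℝ) (φ t)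
    have hmham := ham_eq (Λ := Λ) hMT.1 hmp.1 0 (φ t)
    have hqham : 0 ≤ ham Λ Q 0 (φ t) (q t) := by
      simp only [ham, dotp, Pi.zero_apply, zero_mul, Finset.sum_const_zero, zero_add]
      exact mul_nonneg (by norm_num) (Finset.sum_nonneg fun x _ => Finset.sum_nonneg fun y _ =>
        mul_nonneg (edgeWeight_nonneg hΛ _ x y) (sq_nonneg _))
    rw [ham_stationary hΛ hMT] at hconc
    have hz : ∀ ν : X → ℝ, dotp 0 ν = 0 := fun ν => by simp [dotp]
    rw [hz] at hconc hmham
    have hq' := mul_nonneg (sub_nonneg.2 hθ1) hqham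
    have hgrad : bump 1 t * ((1 / 2) * energy Q pm (φ t)) ≤ (1 / 2) * gradSq Λ Q (m t) (φ t) := by
      rw [zero_add] at hconc hmham
      rw [← hmham]
      linarith
    have hdm : dotp (φ t) (m' t) = bumpDeriv 1 t * (dotp (φ t) pm - dotp (φ t) (q t)) +
        (1 - bump 1 t) * (6 * (t * (1 - t))) * (dotp (φ t) μ1 - dotp (φ t) μ0) := by
      simp only [dotp, hm', ← Finset.sum_sub_distrib, Finset.mul_sum, ← Finset.sum_add_distrib]
      exact Finset.sum_congr rfl fun x _ => by ring
    have hΔ1 := bump_absorb (C := 2 * C) (E := energy Q pm (φ t) / 2) (by positivity)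
      zero_le_one htc (Δ := -(dotp (φ t) pm - dotp (φ t) (q t)))
      (by have := hP (φ t) pm (q t) hpm hqp; nlinarith)
    have hΔ2 := hP (φ t) μ1 μ0 hμ1 hμ0
    have hb : bump 1 t = (t * (1 - t)) ^ 2 := by unfold bump; ring
    have h3 : (1 - bump 1 t) * (6 * (t * (1 - t))) * (dotp (φ t) μ1 - dotp (φ t) μ0) ≤
        bump 1 t * energy Q pm (φ t) / 4 + 36 * C := by
      generalize dotp (φ t) μ1 - dotp (φ t) μ0 = δ at hΔ2
      generalize energy Q pm (φ t) = E at *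
      have hδ : ((1 - bump 1 t) * δ) ^ 2 ≤ C * E := by
        refine le_trans ?_ hΔ2
        rw [mul_pow]
        exact mul_le_of_le_one_left (sq_nonneg _) (pow_le_one₀ (by linarith) (by linarith))
      have h4 : 0 ≤ ((t * (1 - t)) * ((1 - bump 1 t) * δ) - 12 * C) ^ 2 / (4 * C) := by positivity
      have h5 : ((t * (1 - t)) * ((1 - bump 1 t) * δ) - 12 * C) ^ 2 / (4 * C) =
          (t * (1 - t)) ^ 2 * (((1 - bump 1 t) * δ) ^ 2 / C) / 4 -
            (1 - bump 1 t) * (6 * (t * (1 - t))) * δ + 36 * C := by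
        field_simp; ring
      have h6 : ((1 - bump 1 t) * δ) ^ 2 / C ≤ E := by rw [div_le_iff₀ hC]; linarith
      have h7 := mul_le_mul_of_nonneg_left h6 (sq_nonneg (t * (1 - t)))
      rw [← hb] at h5 h7
      linarith
    rw [hdm]
    linarith
  have hfin := (convex_Icc (0 : ℝ) 1).image_sub_le_mul_sub_of_deriv_le hfc
    (by
      rw [interior_Icc]
      exact fun t ht => (hfd t ht).differentiableAt.differentiableWithinAt) (C := 40 * C)
    (by
      rw [interior_Icc]
      exact fun t ht => (hfd t ht).deriv ▸ hle t ht) 0 (by simp) 1 (by simp) zero_le_one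
  have hm1 : m 1 = μ1 := by ext x; simp [hm, hq, hs, bump]; norm_num
  have hm0 : m 0 = μ0 := by ext x; simp [hm, hq, hs, bump]
  simp only [hf, hm1, hm0] at hfin
  linarith

end Subsolutions

section NearOptimalDensity

variable {X : Type*} [Fintype X] {Λ : ℝ → ℝ → ℝ} {Q : X → X → ℝ} {pm : X → ℝ}

lemma ham_sub_const {μ : X → ℝ} (hμ : IsProb μ) (a b : X → ℝ) (r s : ℝ) :
    ham Λ Q (fun x => a x - r) (fun x => b x - s) μ = ham Λ Q a b μ - r := by
  simp only [ham, dotp, sub_sub_sub_cancel_right, sub_mul, Finset.sum_sub_distrib,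
    ← Finset.mul_sum, hμ.2]
  ring

/-- The probability simplex in Euclidean space. -/
def simplex (X : Type*) [Fintype X] : Set (EuclideanSpace ℝ X) := {v | IsProb v.ofLp}

lemma isCompact_simplex : IsCompact (simplex X) := by
  have h := isCompact_stdSimplex ℝ X
  have h2 := h.image (PiLp.continuous_toLp 2 fun _ : X => ℝ)
  convert h2 using 1
  ext v
  constructor
  · intro hv
    exact ⟨v.ofLp, hv, rfl⟩
  · rintro ⟨w, hw, rfl⟩
    exact hw

lemma convex_simplex : Convex ℝ (simplex X) := by
  intro v hv w hw a b ha hb hab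
  obtain rfl : a = 1 - b := by linarith
  exact isProb_convexComb hv hw hb (by linarith)

/-- The space of `C¹` curves in `ℝ^X`. -/
def smoothCurves (X : Type*) [Fintype X] : Submodule ℝ (ℝ → X → ℝ) where
  carrier := {φ | ContDiff ℝ 1 φ}
  add_mem' {φ χ} (h₁ : ContDiff ℝ 1 φ) (h₂ : ContDiff ℝ 1 χ) := h₁.add h₂
  zero_mem' := show ContDiff ℝ 1 fun _ => 0 from contDiff_const
  smul_mem' c φ (h : ContDiff ℝ 1 φ) := h.const_smul c

lemma contDiff_coe (φ : smoothCurves X) : ContDiff ℝ 1 (φ : ℝ → X → ℝ) := φ.2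

lemma hasDerivAt_apply_of_contDiff {φ : ℝ → X → ℝ} (hφ : ContDiff ℝ 1 φ) (t : ℝ) (x : X) :
    HasDerivAt (fun s => φ s x) (deriv φ t x) t :=
  hasDerivAt_pi.1 ((hφ.differentiable one_ne_zero) t).hasDerivAt x

/-- Removing the maximal value of the Hamiltonian turns a curve into a subsolution. -/
lemma dual_sub_integral_le {μ0 μ1 : X → ℝ} (hQ : ∀ x y, 0 ≤ Q x y)
    (hμ0 : IsProb μ0) (hμ1 : IsProb μ1) {D : ℝ}
    (hD : ∀ φ : ℝ → X → ℝ, IsHJ Λ Q 1 φ → dotp (φ 1) μ1 - dotp (φ 0) μ0 ≤ D)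
    {ψ ψ' : ℝ → X → ℝ} (hψ' : Continuous ψ')
    (hψ : ∀ x t, HasDerivAt (fun s => ψ s x) (ψ' t x) t) {c : ℝ → ℝ} (hc : Continuous c)
    (hle : ∀ t μ, IsProb μ → ham Λ Q (ψ' t) (ψ t) μ ≤ c t) :
    dotp (ψ 1) μ1 - dotp (ψ 0) μ0 - ∫ t, c t ∂unitVol ≤ D := by
  have hHJ : IsHJ Λ Q 1 (fun t x => ψ t x - ∫ s in (0 : ℝ)..t, c s) := by
    refine ⟨fun t x => ψ' t x - c t, fun x => ?_, fun x t _ => ?_, fun t _ μ hμ => ?_⟩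
    · exact (((continuous_apply x).comp hψ').sub hc).continuousOn
    · exact ((hψ x t).sub (hc.integral_hasStrictDerivAt 0 t).hasDerivAt).hasDerivWithinAt
    · rw [← ham_eq hQ hμ.1, ham_sub_const hμ]
      linarith [hle t μ hμ]
  refine le_trans (le_of_eq ?_) (hD _ hHJ)
  rw [← intervalIntegral.integral_of_le zero_le_one]
  simp only [dotp, sub_mul, Finset.sum_sub_distrib, ← Finset.mul_sum, hμ0.2, hμ1.2,
    intervalIntegral.integral_same]
  ring

lemma continuous_mix {Y : Type*} (ε : ℝ) (pm : Y → ℝ) :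
    Continuous fun p : ℝ × EuclideanSpace ℝ Y =>
      fun x => (1 - bump ε p.1) * p.2 x + bump ε p.1 * pm x := by
  unfold bump
  fun_prop

lemma dual_sub_integral_mix_le {μ0 μ1 : X → ℝ} (hΛ : AdmissibleMean Λ)
    (hMT : IsMarkovTriple Q pm) (hμ0 : IsProb μ0) (hμ1 : IsProb μ1) {D : ℝ}
    (hD : ∀ φ : ℝ → X → ℝ, IsHJ Λ Q 1 φ → dotp (φ 1) μ1 - dotp (φ 0) μ0 ≤ D) {C : ℝ} (hC : 0 < C)
    (hP : ∀ b μ ν : X → ℝ, IsProb μ → IsProb ν → (dotp b μ - dotp b ν) ^ 2 ≤ C * energy Q pm b)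
    {ε : ℝ} (h0 : 0 ≤ ε) (h1 : ε ≤ 1) {φ : ℝ → X → ℝ} (hφ : ContDiff ℝ 1 φ) :
    dotp (φ 1) μ1 - dotp (φ 0) μ0 - ∫ t, sSup ((fun v : EuclideanSpace ℝ X =>
      ham Λ Q (deriv φ t) (φ t) fun x => (1 - bump ε t) * v x + bump ε t * pm x) '' simplex X)
        ∂unitVol ≤ D + 2 * C * ε := by
  have hφc : Continuous φ := hφ.continuous
  have hφc' : Continuous (deriv φ) := hφ.continuous_deriv le_rfl
  have hbc : Continuous (bump ε) := by unfold bump; fun_prop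
  have hbc' : Continuous (bumpDeriv ε) := by unfold bumpDeriv; fun_prop
  set ψ : ℝ → X → ℝ := fun t x => (1 - bump ε t) * φ t x with hψ
  set ψ' : ℝ → X → ℝ := fun t x => (1 - bump ε t) * deriv φ t x - bumpDeriv ε t * φ t x with hψ'
  have hψc : Continuous ψ := by fun_prop
  have hψc' : Continuous ψ' := by fun_prop
  have hψd : ∀ x t, HasDerivAt (fun s => ψ s x) (ψ' t x) t := by
    intro x t
    have h := ((hasDerivAt_bump ε t).const_sub 1).mul (hasDerivAt_apply_of_contDiff hφ t x)
    convert! h using 1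
    simp only [hψ']; ring
  set F : ℝ → EuclideanSpace ℝ X → ℝ := fun t v => ham Λ Q (ψ' t) (ψ t) v.ofLp with hF
  set G : ℝ → EuclideanSpace ℝ X → ℝ := fun t v =>
    ham Λ Q (deriv φ t) (φ t) fun x => (1 - bump ε t) * v x + bump ε t * pm x with hG
  have hFc : Continuous (Function.uncurry F) :=
    continuous_ham hΛ (hψc'.comp continuous_fst) (hψc.comp continuous_fst)
      ((PiLp.continuous_ofLp 2 _).comp continuous_snd)
  have hGc : Continuous (Function.uncurry G) :=
    continuous_ham hΛ (hφc'.comp continuous_fst) (hφc.comp continuous_fst) (continuous_mix ε pm)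
  have hFs := isCompact_simplex.continuous_sSup (f := F) hFc
  have hGs := isCompact_simplex.continuous_sSup (f := G) hGc
  have hFb : ∀ t, BddAbove (F t '' simplex X) := fun t => (isCompact_simplex.image
    (hFc.comp (Continuous.prodMk_right t))).bddAbove
  have hGb : ∀ t, BddAbove (G t '' simplex X) := fun t => (isCompact_simplex.image
    (hGc.comp (Continuous.prodMk_right t))).bddAbove
  have hmain := dual_sub_integral_le hMT.1 hμ0 hμ1 hD hψc' hψd hFs fun t μ hμ =>
    le_csSup (hFb t) ⟨WithLp.toLp 2 μ, hμ, rfl⟩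
  set r : ℝ → ℝ := fun t => bump ε t * dotp (deriv φ t) pm + bumpDeriv ε t * dotp (φ t) pm with hr
  have hrc : Continuous r := by unfold r dotp; fun_prop
  have hrd : ∀ t, HasDerivAt (fun t => bump ε t * dotp (φ t) pm) (r t) t := by
    intro t
    have h : HasDerivAt (fun t => dotp (φ t) pm) (dotp (deriv φ t) pm) t :=
      HasDerivAt.fun_sum fun x _ => (hasDerivAt_apply_of_contDiff hφ t x).mul_const (pm x)
    convert! (hasDerivAt_bump ε t).mul h using 1
    simp only [hr]; ring
  have hri : ∫ t, r t ∂unitVol = 0 := by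
    rw [← intervalIntegral.integral_of_le zero_le_one,
      intervalIntegral.integral_eq_sub_of_hasDerivAt (fun t _ => hrd t)
        (hrc.intervalIntegrable 0 1)]
    simp [bump]
  have hi : ∀ {f : ℝ → ℝ}, Continuous f → Integrable f unitVol := fun hf =>
    intervalIntegrable_iff_unitVol.1 (hf.intervalIntegrable 0 1)
  have hcmp : ∫ t, (sSup (F t '' simplex X) + r t - 2 * C * ε) ∂unitVol ≤
      ∫ t, sSup (G t '' simplex X) ∂unitVol := by
    refine integral_mono_ae (hi (by fun_prop)) (hi hGs) ?_
    filter_upwards [ae_unitVol_mem] with t ht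
    have : sSup (F t '' simplex X) ≤ sSup (G t '' simplex X) - r t + 2 * C * ε := by
      refine csSup_le (Set.Nonempty.image _ ⟨WithLp.toLp 2 μ0, hμ0⟩) ?_
      rintro _ ⟨v, hv, rfl⟩
      have h2 := ham_mix_ge hΛ hMT hC hP h0 h1 (Ioc_subset_Icc_self ht) hv (deriv φ t) (φ t)
      have h3 := le_csSup (hGb t) ⟨v, hv, rfl⟩
      simp only [hF, hG, hr] at *
      linarith
    show sSup (F t '' simplex X) + r t - 2 * C * ε ≤ sSup (G t '' simplex X)
    linarith
  rw [integral_sub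
    (hi (f := fun t => sSup (F t '' simplex X) + r t) (hFs.add hrc)) (integrable_const _),
    integral_add (hi hFs) (hi hrc), hri] at hcmp
  have hψ1 : ψ 1 = φ 1 := by ext x; simp [hψ, bump]
  have hψ0 : ψ 0 = φ 0 := by ext x; simp [hψ, bump]
  rw [hψ1, hψ0] at hmain
  have hconst : ∫ _, 2 * C * ε ∂unitVol = 2 * C * ε := by simp
  rw [hconst] at hcmp
  linarith

/-- The linear functional of the dual problem. -/
noncomputable def dualMap (μ0 μ1 : X → ℝ) : smoothCurves X →ₗ[ℝ] ℝ where
  toFun φ := dotp (φ.1 1) μ1 - dotp (φ.1 0) μ0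
  map_add' φ χ := by
    simp only [dotp, Submodule.coe_add, Pi.add_apply, add_mul, Finset.sum_add_distrib]
    ring
  map_smul' r φ := by
    simp only [dotp, Submodule.coe_smul, Pi.smul_apply, smul_eq_mul, mul_assoc,
      ← Finset.mul_sum, RingHom.id_apply]
    ring

lemma deriv_combination (φ χ : smoothCurves X) (a b t : ℝ) :
    deriv (a • φ + b • χ : smoothCurves X).1 t = a • deriv φ.1 t + b • deriv χ.1 t := by
  have h₁ := ((contDiff_coe φ).differentiable one_ne_zero t).hasDerivAt.const_smul a
  have h₂ := ((contDiff_coe χ).differentiable one_ne_zero t).hasDerivAt.const_smul b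
  exact (h₁.add h₂).deriv

/-- The Hamiltonian of a curve at a density mixed with stationary mass. -/
noncomputable def mixHam (Λ : ℝ → ℝ → ℝ) (Q : X → X → ℝ) (pm : X → ℝ) (ε : ℝ)
    (φ : smoothCurves X) (t : ℝ) (v : EuclideanSpace ℝ X) : ℝ :=
  ham Λ Q (deriv φ.1 t) (φ.1 t) fun x => (1 - bump ε t) * v x + bump ε t * pm x

lemma continuous_mixHam (hΛ : AdmissibleMean Λ) (ε : ℝ) (φ : smoothCurves X) :
    Continuous (Function.uncurry (mixHam Λ Q pm ε φ)) :=
  continuous_ham hΛ (((contDiff_coe φ).continuous_deriv le_rfl).comp continuous_fst)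
    ((contDiff_coe φ).continuous.comp continuous_fst) (continuous_mix ε pm)

lemma concaveOn_mixHam (hΛ : AdmissibleMean Λ) (hQ : ∀ x y, 0 ≤ Q x y) (hpm : IsProb pm) {ε t : ℝ}
    (h0 : 0 ≤ bump ε t) (h1 : bump ε t ≤ 1) (φ : smoothCurves X) :
    ConcaveOn ℝ (simplex X) (mixHam Λ Q pm ε φ t) := by
  refine ⟨convex_simplex, fun v hv w hw a b ha hb hab => ?_⟩
  obtain rfl : a = 1 - b := by linarith
  have h := ham_concave hΛ hQ (isProb_convexComb hv hpm h0 h1).1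
    (isProb_convexComb hw hpm h0 h1).1 hb (by linarith) (deriv φ.1 t) (φ.1 t)
  refine h.trans_eq ?_
  rw [mixHam]
  congr 1
  ext x
  simp only [PiLp.add_apply, PiLp.smul_apply, smul_eq_mul]
  ring

lemma convexOn_mixHam (hΛ : AdmissibleMean Λ) (ε t : ℝ) (v : EuclideanSpace ℝ X) :
    ConvexOn ℝ univ fun φ => mixHam Λ Q pm ε φ t v := by
  refine ⟨convex_univ, fun φ _ χ _ a b ha hb hab => ?_⟩
  simp only [mixHam, deriv_combination, smul_eq_mul]
  exact ham_convex hΛ _ _ _ _ _ ha hb hab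

/-- Almost optimal densities for the dual problem, bounded away from zero inside the interval. -/
lemma exists_near_optimal_density {μ0 μ1 : X → ℝ} (hΛ : AdmissibleMean Λ)
    (hMT : IsMarkovTriple Q pm) (hμ0 : IsProb μ0) (hμ1 : IsProb μ1) {D : ℝ}
    (hD : ∀ φ : ℝ → X → ℝ, IsHJ Λ Q 1 φ → dotp (φ 1) μ1 - dotp (φ 0) μ0 ≤ D) {C : ℝ} (hC : 0 < C)
    (hP : ∀ b μ ν : X → ℝ, IsProb μ → IsProb ν → (dotp b μ - dotp b ν) ^ 2 ≤ C * energy Q pm b)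
    {ε : ℝ} (h0 : 0 < ε) (h1 : ε ≤ 1) :
    ∃ m : ℝ → X → ℝ, AEStronglyMeasurable m unitVol ∧
      (∀ᵐ t ∂unitVol, IsProb (m t) ∧ ∀ x, 0 < m t x) ∧
      ∀ φ : ℝ → X → ℝ, ContDiff ℝ 1 φ → dotp (φ 1) μ1 - dotp (φ 0) μ0 -
        ∫ t, ham Λ Q (deriv φ t) (φ t) (m t) ∂unitVol ≤ D + (2 * C + 1) * ε := by
  have hpm := hMT.2.2.2.1
  have hbI : ∀ t ∈ Ioc (0 : ℝ) 1, 0 ≤ bump ε t ∧ bump ε t ≤ 1 := fun t ht =>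
    ⟨bump_nonneg h0.le t, (bump_le h0.le (Ioc_subset_Icc_self ht)).trans h1⟩
  obtain ⟨n, hn, hnK, hnle⟩ := exists_forall_sub_integral_le (isCompact_simplex (X := X))
    ⟨WithLp.toLp 2 μ0, hμ0⟩ convex_simplex (dualMap μ0 μ1) (G := mixHam Λ Q pm ε)
    (c := D + 2 * C * ε) (c' := D + (2 * C + 1) * ε) (continuous_mixHam hΛ ε)
    (fun φ t ht => concaveOn_mixHam hΛ hMT.1 hpm (hbI t ht).1 (hbI t ht).2 φ)
    (convexOn_mixHam hΛ ε) (by linarith)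
    (fun φ => dual_sub_integral_mix_le hΛ hMT hμ0 hμ1 hD hC hP h0.le h1 (contDiff_coe φ))
  have hpair : AEStronglyMeasurable (fun t : ℝ => (t, n t)) unitVol :=
    measurable_id.aestronglyMeasurable.prodMk hn
  have hmix : AEStronglyMeasurable
      ((fun p : ℝ × EuclideanSpace ℝ X => fun x => (1 - bump ε p.1) * p.2 x + bump ε p.1 * pm x) ∘
        fun t => (t, n t)) unitVol := (continuous_mix ε pm).comp_aestronglyMeasurable hpair
  refine ⟨fun t x => (1 - bump ε t) * n t x + bump ε t * pm x, hmix, ?_,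
    fun φ hφ => hnle ⟨φ, hφ⟩⟩
  have hne : ∀ᵐ t ∂unitVol, t ≠ 1 := ae_restrict_of_ae (Measure.ae_ne volume (1 : ℝ))
  filter_upwards [hnK, ae_unitVol_mem, hne] with t hnt ht ht1
  have hb := hbI t ht
  refine ⟨isProb_convexComb hnt hpm hb.1 hb.2, fun x => ?_⟩
  have h2 := mul_pos (bump_pos h0 ⟨ht.1, lt_of_le_of_ne ht.2 ht1⟩) (hMT.2.2.2.2.1 x)
  have h3 := mul_nonneg (sub_nonneg.2 hb.2) (hnt.1 x)
  linarith

end NearOptimalDensity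

section Representation

variable {P H : Type*} [AddCommGroup P] [Module ℝ P] [NormedAddCommGroup H]
  [InnerProductSpace ℝ H]

lemma sq_le_of_forall_mul_sub_le {l c N : ℝ} (h : ∀ s : ℝ, s * l - (1 / 4) * (s ^ 2 * N) ≤ c)
    (hN : 0 ≤ N) : l ^ 2 ≤ c * N := by
  rcases hN.eq_or_lt with rfl | hN
  · by_contra hl
    have hl0 : l ≠ 0 := fun h0 => hl (by simp [h0])
    have := h ((c + 1) / l)
    rw [div_mul_cancel₀ _ hl0] at this
    linarith
  · have := h (2 * l / N)
    have h2 : 2 * l / N * l - (1 / 4) * ((2 * l / N) ^ 2 * N) = l ^ 2 / N := by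
      field_simp; ring
    rwa [h2, div_le_iff₀ hN] at this

/-- A Riesz representation for linear functionals dominated by a quadratic form. -/
lemma exists_inner_eq_of_sub_sq_le [CompleteSpace H] (l : P →ₗ[ℝ] ℝ) (T : P →ₗ[ℝ] H) {c : ℝ}
    (h : ∀ p, l p - (1 / 4) * ‖T p‖ ^ 2 ≤ c) :
    ∃ Z : H, ‖Z‖ ^ 2 ≤ c ∧ ∀ p, l p = inner ℝ Z (T p) := by
  have hc : 0 ≤ c := by simpa using h 0
  have hle : ∀ p, ‖l p‖ ≤ √c * ‖T p‖ := by
    intro p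
    have h1 : l p ^ 2 ≤ c * ‖T p‖ ^ 2 := by
      refine sq_le_of_forall_mul_sub_le (fun s => ?_) (sq_nonneg _)
      have := h (s • p)
      rw [map_smul, map_smul, norm_smul, mul_pow, Real.norm_eq_abs, sq_abs] at this
      simpa using this
    have h2 := Real.abs_le_sqrt h1
    rwa [Real.sqrt_mul hc, Real.sqrt_sq (norm_nonneg _)] at h2
  have hker : LinearMap.ker T ≤ LinearMap.ker l := by
    intro p hp
    have := hle p
    rw [LinearMap.mem_ker.1 hp, norm_zero, mul_zero] at this
    exact LinearMap.mem_ker.2 (norm_le_zero_iff.1 this)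
  set f : LinearMap.range T →ₗ[ℝ] ℝ :=
    ((LinearMap.ker T).liftQ l hker).comp T.quotKerEquivRange.symm.toLinearMap with hf
  have hfT : ∀ p, f ⟨T p, LinearMap.mem_range_self T p⟩ = l p := by
    intro p
    simp only [hf, LinearMap.comp_apply, LinearEquiv.coe_coe,
      LinearMap.quotKerEquivRange_symm_apply_image, Submodule.mkQ_apply, Submodule.liftQ_apply]
  have hfb : ∀ v, ‖f v‖ ≤ √c * ‖v‖ := by
    rintro ⟨_, p, rfl⟩
    rw [hfT]
    exact hle p
  obtain ⟨g, hg, hgn⟩ := exists_extension_norm_eq (LinearMap.range T) (f.mkContinuous _ hfb)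
  refine ⟨(InnerProductSpace.toDual ℝ H).symm g, ?_, fun p => ?_⟩
  · rw [LinearIsometryEquiv.norm_map, hgn]
    exact (pow_le_pow_left₀ (norm_nonneg _)
      (f.mkContinuous_norm_le (Real.sqrt_nonneg c) hfb) 2).trans_eq (Real.sq_sqrt hc)
  · rw [InnerProductSpace.toDual_symm_apply, hg ⟨T p, LinearMap.mem_range_self T p⟩,
      LinearMap.mkContinuous_apply, hfT]

end Representation

section Flux

variable {X : Type*} [Fintype X] {Λ : ℝ → ℝ → ℝ} {Q : X → X → ℝ} {pm : X → ℝ}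

lemma memLp_comp_density {E : Type*} [NormedAddCommGroup E] {G : ℝ × (X → ℝ) → E}
    (hG : Continuous G) {m : ℝ → X → ℝ} (hm : AEStronglyMeasurable m unitVol)
    (hmp : ∀ᵐ t ∂unitVol, IsProb (m t)) (p : ℝ≥0∞) : MemLp (fun t => G (t, m t)) p unitVol := by
  obtain ⟨M, hM⟩ := (isCompact_Icc.prod (isCompact_stdSimplex ℝ X)).exists_bound_of_continuousOn
    (s := Icc (0 : ℝ) 1 ×ˢ stdSimplex ℝ X) hG.continuousOn
  have hpair : AEStronglyMeasurable (fun t : ℝ => (t, m t)) unitVol :=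
    measurable_id.aestronglyMeasurable.prodMk hm
  refine MemLp.of_bound (hG.comp_aestronglyMeasurable hpair) M ?_
  filter_upwards [hmp, ae_unitVol_mem] with t h1 h2
  exact hM (t, m t) ⟨Ioc_subset_Icc_self h2, h1⟩

/-- The discrete gradient of `b`, weighted by the square roots of the edge weights. -/
noncomputable def weightedGrad (Λ : ℝ → ℝ → ℝ) (Q : X → X → ℝ) (μ b : X → ℝ) :
    EuclideanSpace ℝ (X × X) :=
  WithLp.toLp 2 fun e => √(edgeWeight Λ Q μ e.1 e.2) * (b e.2 - b e.1)

lemma continuous_weightedGrad {Y : Type*} {Q : Y → Y → ℝ} (hΛ : AdmissibleMean Λ)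
    {φ : ℝ → Y → ℝ} (hφ : Continuous φ) :
    Continuous fun p : ℝ × (Y → ℝ) => weightedGrad Λ Q p.2 (φ p.1) := by
  have hw : ∀ x z, Continuous fun p : ℝ × (Y → ℝ) => edgeWeight Λ Q p.2 x z := fun x z =>
    (continuous_edgeWeight hΛ x z).comp continuous_snd
  unfold weightedGrad
  fun_prop

lemma norm_sq_weightedGrad (hΛ : AdmissibleMean Λ) (μ b : X → ℝ) :
    ‖weightedGrad Λ Q μ b‖ ^ 2 = ∑ x, ∑ y, edgeWeight Λ Q μ x y * (b y - b x) ^ 2 := by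
  rw [EuclideanSpace.real_norm_sq_eq, Fintype.sum_prod_type]
  simp only [weightedGrad, mul_pow, Real.sq_sqrt (edgeWeight_nonneg hΛ _ _ _)]

/-- The representation of the continuity equation by an `L²` flux. -/
lemma exists_flux (hΛ : AdmissibleMean Λ) {μ0 μ1 : X → ℝ} {m : ℝ → X → ℝ}
    (hm : AEStronglyMeasurable m unitVol) (hmp : ∀ᵐ t ∂unitVol, IsProb (m t)) {c : ℝ}
    (h : ∀ φ : ℝ → X → ℝ, ContDiff ℝ 1 φ → dotp (φ 1) μ1 - dotp (φ 0) μ0 -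
      ∫ t, ham Λ Q (deriv φ t) (φ t) (m t) ∂unitVol ≤ c) :
    ∃ Z : Lp (EuclideanSpace ℝ (X × X)) 2 unitVol, ‖Z‖ ^ 2 ≤ c ∧
      ∀ φ : ℝ → X → ℝ, ContDiff ℝ 1 φ →
        dotp (φ 1) μ1 - dotp (φ 0) μ0 - ∫ t, dotp (deriv φ t) (m t) ∂unitVol =
          ∫ t, inner ℝ (Z t) (weightedGrad Λ Q (m t) (φ t)) ∂unitVol := by
  have hT : ∀ φ : smoothCurves X, MemLp (fun t => weightedGrad Λ Q (m t) (φ.1 t)) 2 unitVol :=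
    fun φ => memLp_comp_density (continuous_weightedGrad hΛ (contDiff_coe φ).continuous) hm hmp 2
  have hdc : ∀ φ : smoothCurves X,
      Integrable (fun t => dotp (deriv φ.1 t) (m t)) unitVol := by
    intro φ
    have hc := (contDiff_coe φ).continuous_deriv le_rfl
    have : Continuous fun p : ℝ × (X → ℝ) => dotp (deriv φ.1 p.1) p.2 := by
      unfold dotp; fun_prop
    exact memLp_one_iff_integrable.1 (memLp_comp_density this hm hmp 1)
  set T : smoothCurves X →ₗ[ℝ] Lp (EuclideanSpace ℝ (X × X)) 2 unitVol :=
    { toFun := fun φ => (hT φ).toLp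
      map_add' := fun φ χ => by
        rw [← MemLp.toLp_add]
        refine MemLp.toLp_congr _ _ (ae_of_all _ fun t => ?_)
        ext e
        simp only [weightedGrad, Submodule.coe_add, Pi.add_apply, PiLp.add_apply]
        ring
      map_smul' := fun r φ => by
        rw [RingHom.id_apply, ← MemLp.toLp_const_smul]
        refine MemLp.toLp_congr _ _ (ae_of_all _ fun t => ?_)
        ext e
        simp only [weightedGrad, Submodule.coe_smul, Pi.smul_apply, PiLp.smul_apply, smul_eq_mul]
        ring } with hTdef
  set I : smoothCurves X →ₗ[ℝ] ℝ :=
    { toFun := fun φ => ∫ t, dotp (deriv φ.1 t) (m t) ∂unitVol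
      map_add' := fun φ χ => by
        rw [← integral_add (hdc φ) (hdc χ)]
        refine integral_congr_ae (ae_of_all _ fun t => ?_)
        have := deriv_combination φ χ 1 1 t
        rw [one_smul, one_smul, one_smul, one_smul] at this
        simp only [this, dotp, Pi.add_apply, add_mul, Finset.sum_add_distrib]
      map_smul' := fun r φ => by
        rw [RingHom.id_apply, smul_eq_mul, ← integral_const_mul]
        refine integral_congr_ae (ae_of_all _ fun t => ?_)
        have := deriv_combination φ 0 r 0 t
        rw [zero_smul, zero_smul, add_zero, add_zero] at this
        simp only [this, dotp, Pi.smul_apply, smul_eq_mul, mul_assoc, Finset.mul_sum] } with hI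
  have hnorm : ∀ φ, ‖T φ‖ ^ 2 = ∫ t, ‖weightedGrad Λ Q (m t) (φ.1 t)‖ ^ 2 ∂unitVol := by
    intro φ
    rw [← real_inner_self_eq_norm_sq, L2.inner_def]
    refine integral_congr_ae ?_
    filter_upwards [(hT φ).coeFn_toLp] with t ht
    rw [← real_inner_self_eq_norm_sq]
    exact congrArg₂ _ ht ht
  obtain ⟨Z, hZ, hZeq⟩ := exists_inner_eq_of_sub_sq_le (dualMap μ0 μ1 - I) T (c := c) (by
    intro φ
    refine le_trans (le_of_eq ?_) (h φ.1 (contDiff_coe φ))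
    have hsq : Integrable (fun t => ‖weightedGrad Λ Q (m t) (φ.1 t)‖ ^ 2) unitVol :=
      MemLp.integrable_norm_pow (p := 2) (hT φ) two_ne_zero
    have : ∫ t, ham Λ Q (deriv φ.1 t) (φ.1 t) (m t) ∂unitVol =
        I φ + (1 / 4) * ∫ t, ‖weightedGrad Λ Q (m t) (φ.1 t)‖ ^ 2 ∂unitVol := by
      rw [← integral_const_mul, hI]
      simp only [LinearMap.coe_mk, AddHom.coe_mk]
      rw [← integral_add (hdc φ) (hsq.const_mul _)]
      simp only [ham, norm_sq_weightedGrad hΛ]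
    rw [this, hnorm, LinearMap.sub_apply]
    simp only [dualMap, LinearMap.coe_mk, AddHom.coe_mk]
    ring)
  refine ⟨Z, hZ, fun φ hφ => (hZeq ⟨φ, hφ⟩).trans ?_⟩
  rw [L2.inner_def]
  refine integral_congr_ae ?_
  filter_upwards [(hT ⟨φ, hφ⟩).coeFn_toLp] with t ht
  exact congrArg _ ht

end Flux

section StrongDuality

variable {X : Type*} [Fintype X] {Λ : ℝ → ℝ → ℝ} {Q : X → X → ℝ} {pm : X → ℝ}

/-- The fundamental lemma of the calculus of variations for curves with a free endpoint. -/
lemma eq_zero_of_forall_dotp_eq_integral {a : X → ℝ} {r : ℝ → X → ℝ}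
    (hr : ∀ x, Integrable (fun t => r t x) unitVol)
    (h : ∀ φ : ℝ → X → ℝ, ContDiff ℝ 1 φ →
      dotp (φ 1) a = ∫ t, dotp (deriv φ t) (r t) ∂unitVol) :
    a = 0 ∧ ∀ᵐ t ∂unitVol, r t = 0 := by
  classical
  have ha : a = 0 := by
    ext x
    have := h (fun _ => Pi.single x 1) contDiff_const
    simpa [dotp, Pi.single_apply] using this
  refine ⟨ha, ?_⟩
  have hx : ∀ x, ∀ᵐ t ∂unitVol, r t x = 0 := by
    intro x
    refine ae_eq_zero_of_integral_contDiff_smul_eq_zero (hr x).locallyIntegrable fun ζ hζ _ => ?_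
    have hζc : Continuous ζ := hζ.continuous
    have hd : ∀ t, HasDerivAt (fun t => Pi.single x (∫ s in (0 : ℝ)..t, ζ s))
        (Pi.single x (ζ t) : X → ℝ) t := by
      intro t
      refine hasDerivAt_pi.2 fun y => ?_
      rcases eq_or_ne y x with rfl | hy
      · simpa using (hζc.integral_hasStrictDerivAt 0 t).hasDerivAt
      · simpa [Pi.single_eq_of_ne hy] using hasDerivAt_const t (0 : ℝ)
    have hderiv := funext fun t => (hd t).deriv
    have hcd : ContDiff ℝ 1 fun t => (Pi.single x (∫ s in (0 : ℝ)..t, ζ s) : X → ℝ) := by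
      refine contDiff_one_iff_deriv.2 ⟨fun t => (hd t).differentiableAt, ?_⟩
      rw [hderiv]
      exact (continuous_single x).comp hζc
    have := h _ hcd
    rw [hderiv, ha] at this
    simpa [dotp, Pi.single_apply] using this.symm
  filter_upwards [ae_all_iff.2 hx] with t ht
  exact funext ht

lemma isProb_of_ae {μ : ℝ → X → ℝ} (hc : ∀ x, ContinuousOn (fun t => μ t x) (Icc 0 1))
    (h : ∀ᵐ t ∂unitVol, IsProb (μ t)) : ∀ t ∈ Icc (0 : ℝ) 1, IsProb (μ t) := by
  rw [unitVol, restrict_Ioc_eq_restrict_Icc] at h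
  refine fun t ht => ⟨fun x => ?_, ?_⟩
  · have := Measure.eqOn_Icc_of_ae_eq volume zero_ne_one (f := fun t => max (μ t x) 0)
      (g := fun t => μ t x) (by filter_upwards [h] with t ht using max_eq_left (ht.1 x))
      ((hc x).sup continuousOn_const) (hc x) ht
    exact (le_max_right (μ t x) 0).trans_eq this
  · exact Measure.eqOn_Icc_of_ae_eq volume zero_ne_one (f := fun t => ∑ x, μ t x)
      (g := fun _ => (1 : ℝ)) (by filter_upwards [h] with t ht using ht.2)
      (continuousOn_finsetSum _ fun x _ => hc x) continuousOn_const ht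

lemma Afun_sqrt_le (hΛ : AdmissibleMean Λ) (hMT : IsMarkovTriple Q pm) {μ : X → ℝ}
    (hμ : ∀ x, 0 < μ x) (x y : X) (z : ℝ) :
    Afun Λ (μ x * Q x y) (μ y * Q y x) (2 * (√(edgeWeight Λ Q μ x y) * z)) ≤
      ENNReal.ofReal (4 * z ^ 2) := by
  obtain ⟨hQ, -, -, -, hpos, hrev⟩ := hMT
  rw [edgeWeight_eq hQ fun x => (hμ x).le]
  rcases (hQ x y).eq_or_lt with h | h
  · have h' : Q y x = 0 := by
      have := hrev x y
      rw [← h, mul_zero] at this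
      exact (mul_eq_zero.1 this.symm).resolve_left (hpos y).ne'
    simp [← h, h', Afun, mean_self hΛ le_rfl]
  · have h' : 0 < Q y x := by
      have := hrev x y
      exact pos_of_mul_pos_right (this ▸ mul_pos (hpos x) h) (hpos y).le
    have hs := mul_pos (hμ x) h
    have ht := mul_pos (hμ y) h'
    have hw := mean_pos hΛ hs ht
    rw [Afun, if_pos ⟨hs, ht⟩, mul_pow, mul_pow, Real.sq_sqrt hw.le]
    refine ENNReal.ofReal_le_ofReal (le_of_eq ?_)
    field_simp
    ring

lemma action_sqrt_le (hΛ : AdmissibleMean Λ) (hMT : IsMarkovTriple Q pm) {μ : X → ℝ}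
    (hμ : ∀ x, 0 < μ x) (z : EuclideanSpace ℝ (X × X)) :
    action Λ Q μ (fun x y => 2 * (√(edgeWeight Λ Q μ x y) * z (x, y))) ≤
      ENNReal.ofReal (2 * ‖z‖ ^ 2) := by
  have h : ENNReal.ofReal (2 * ‖z‖ ^ 2) = (∑ x, ∑ y, ENNReal.ofReal (4 * z (x, y) ^ 2)) / 2 := by
    rw [EuclideanSpace.real_norm_sq_eq, Fintype.sum_prod_type]
    have h2 : (2 : ℝ) * ∑ x, ∑ y, z (x, y) ^ 2 = (∑ x, ∑ y, 4 * z (x, y) ^ 2) / 2 := by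
      simp only [← Finset.mul_sum]; ring
    rw [h2, ENNReal.ofReal_div_of_pos two_pos, ENNReal.ofReal_ofNat, ENNReal.ofReal_sum_of_nonneg
      fun x _ => Finset.sum_nonneg fun y _ => by positivity]
    congr 1
    exact Finset.sum_congr rfl fun x _ => ENNReal.ofReal_sum_of_nonneg fun y _ => by positivity
  rw [h, action]
  exact ENNReal.div_le_div_right (Finset.sum_le_sum fun x _ => Finset.sum_le_sum fun y _ =>
    Afun_sqrt_le hΛ hMT hμ x y _) _

/-- An almost optimal density yields a curve of small action. -/
lemma Wsq_le_of_density (hΛ : AdmissibleMean Λ) (hMT : IsMarkovTriple Q pm) {μ0 μ1 : X → ℝ}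
    {m : ℝ → X → ℝ} (hm : AEStronglyMeasurable m unitVol)
    (hmp : ∀ᵐ t ∂unitVol, IsProb (m t) ∧ ∀ x, 0 < m t x) {c : ℝ}
    (h : ∀ φ : ℝ → X → ℝ, ContDiff ℝ 1 φ → dotp (φ 1) μ1 - dotp (φ 0) μ0 -
      ∫ t, ham Λ Q (deriv φ t) (φ t) (m t) ∂unitVol ≤ c) :
    Wsq Λ Q μ0 μ1 ≤ ENNReal.ofReal (2 * c) := by
  have hmp' : ∀ᵐ t ∂unitVol, IsProb (m t) := hmp.mono fun t ht => ht.1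
  obtain ⟨Z, hZ, hZeq⟩ := exists_flux hΛ hm hmp' h
  set V : ℝ → X → X → ℝ := fun t x y => 2 * (√(edgeWeight Λ Q (m t) x y) * Z t (x, y)) with hV
  have hVi : ∀ x y, Integrable (fun t => V t x y) unitVol := by
    intro x y
    have h1 : MemLp (fun t => √(edgeWeight Λ Q (m t) x y)) 2 unitVol :=
      memLp_comp_density (G := fun p : ℝ × (X → ℝ) => √(edgeWeight Λ Q p.2 x y))
        ((continuous_edgeWeight hΛ x y).comp continuous_snd).sqrt hm hmp' 2
    have h2 : MemLp (fun t => Z t (x, y)) 2 unitVol :=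
      (EuclideanSpace.proj (𝕜 := ℝ) (x, y)).comp_memLp' (Lp.memLp Z)
    exact (h1.integrable_mul h2).const_mul 2
  set g : ℝ → X → ℝ := fun t x => -((1 / 2) * ∑ y, (V t x y - V t y x)) with hg
  have hgi : ∀ x, Integrable (fun t => g t x) unitVol := fun x =>
    ((integrable_finsetSum _ fun y _ => (hVi x y).sub (hVi y x)).const_mul _).neg
  set μ : ℝ → X → ℝ := fun t x => μ0 x + ∫ s in (0 : ℝ)..t, g s x with hμ
  have hμc : ∀ x, ContinuousOn (fun t => μ t x) (Icc 0 1) := by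
    intro x
    have := (intervalIntegrable_iff_unitVol.2
      (hgi x)).absolutelyContinuousOnInterval_intervalIntegral (c := 0) (by simp)
    have h2 := this.continuousOn
    rw [uIcc_of_le zero_le_one] at h2
    exact continuousOn_const.add h2
  have hμi : ∀ x, Integrable (fun t => μ t x) unitVol := fun x =>
    intervalIntegrable_iff_unitVol.1 (ContinuousOn.intervalIntegrable
      (by rw [uIcc_of_le zero_le_one]; exact hμc x))
  have hmi : ∀ x, Integrable (fun t => m t x) unitVol := fun x =>
    memLp_one_iff_integrable.1 (memLp_comp_density (G := fun p : ℝ × (X → ℝ) => p.2 x)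
      (by fun_prop) hm hmp' 1)
  have hμ0 : μ 0 = μ0 := by ext x; simp [hμ]
  have hinner : ∀ t b, inner ℝ (Z t) (weightedGrad Λ Q (m t) b) = dotp b (g t) := by
    intro t b
    rw [hg, dotp_neg_div, PiLp.inner_apply, Fintype.sum_prod_type, Finset.mul_sum]
    refine Finset.sum_congr rfl fun x _ => ?_
    rw [Finset.mul_sum]
    refine Finset.sum_congr rfl fun y _ => ?_
    simp only [weightedGrad, hV, RCLike.inner_apply, conj_trivial]
    ring
  obtain ⟨hend, hae⟩ := eq_zero_of_forall_dotp_eq_integral (a := fun x => μ1 x - μ 1 x)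
    (r := fun t x => m t x - μ t x) (fun x => (hmi x).sub (hμi x)) (by
      intro φ hφ
      have h1 := hZeq φ hφ
      have hφc := hφ.continuous
      have hφc' := hφ.continuous_deriv le_rfl
      obtain ⟨hinteg, heq⟩ := integral_dotp_primitive (φ := φ) (φ' := deriv φ) (g := g) (μ := μ)
        (m₀ := μ0) (fun x => ((continuous_apply x).comp hφc').continuousOn)
        (fun x t _ => (hasDerivAt_apply_of_contDiff hφ t x).hasDerivWithinAt) hgi
        (fun x t _ => rfl)
      have hdm : ∀ {ν : ℝ → X → ℝ}, (∀ x, Integrable (fun t => ν t x) unitVol) →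
          Integrable (fun t => dotp (deriv φ t) (ν t)) unitVol := fun hν =>
        integrable_finsetSum _ fun x _ => intervalIntegrable_iff_unitVol.1
          ((intervalIntegrable_iff_unitVol.2 (hν x)).continuousOn_mul
            ((continuous_apply x).comp hφc').continuousOn)
      have hdg : Integrable (fun t => dotp (φ t) (g t)) unitVol :=
        integrable_finsetSum _ fun x _ => intervalIntegrable_iff_unitVol.1
          ((intervalIntegrable_iff_unitVol.2 (hgi x)).continuousOn_mul
            ((continuous_apply x).comp hφc).continuousOn)
      have hsub : ∀ b ν₁ ν₂ : X → ℝ, dotp b (fun x => ν₁ x - ν₂ x) = dotp b ν₁ - dotp b ν₂ :=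
        fun b ν₁ ν₂ => by simp only [dotp, mul_sub, Finset.sum_sub_distrib]
      rw [integral_add (hdm hμi) hdg, hμ0] at heq
      simp only [hinner] at h1
      simp only [hsub]
      rw [integral_sub (hdm hmi) (hdm hμi)]
      linarith)
  have hμm : ∀ᵐ t ∂unitVol, μ t = m t := by
    filter_upwards [hae] with t ht
    ext x
    have := congrFun ht x
    simp only [Pi.zero_apply] at this
    linarith
  have hCE : IsCE1 μ0 μ1 μ V := by
    refine ⟨hμc, fun x y => intervalIntegrable_iff_unitVol.2 (hVi x y), isProb_of_ae hμc ?_, hμ0,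
      ?_, fun x t _ => ?_⟩
    · filter_upwards [hμm, hmp'] with t h1 h2 using h1 ▸ h2
    · ext x
      have := congrFun hend x
      simp only [Pi.zero_apply] at this
      linarith
    · simp only [hμ, hg, intervalIntegral.integral_neg]
      ring
  refine (iInf₂_le_of_le μ V (iInf_le _ hCE)).trans ?_
  have hsq : Integrable (fun t => ‖Z t‖ ^ 2) unitVol :=
    MemLp.integrable_norm_pow (p := 2) (Lp.memLp Z) two_ne_zero
  have hZn : ∫ t, ‖Z t‖ ^ 2 ∂unitVol = ‖Z‖ ^ 2 := by
    rw [← real_inner_self_eq_norm_sq, L2.inner_def]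
    simp only [real_inner_self_eq_norm_sq]
  calc curveAction Λ Q μ V = ∫⁻ t, action Λ Q (μ t) (V t) ∂unitVol := by
        rw [curveAction, unitVol, restrict_Ioc_eq_restrict_Icc]
    _ ≤ ∫⁻ t, ENNReal.ofReal (2 * ‖Z t‖ ^ 2) ∂unitVol := by
        refine lintegral_mono_ae ?_
        filter_upwards [hμm, hmp] with t h1 h2
        rw [h1]
        exact action_sqrt_le hΛ hMT h2.2 (Z t)
    _ = ENNReal.ofReal (2 * ‖Z‖ ^ 2) := by
        rw [← ofReal_integral_eq_lintegral_ofReal (hsq.const_mul 2)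
          (ae_of_all _ fun t => by positivity), integral_const_mul, hZn]
    _ ≤ ENNReal.ofReal (2 * c) := ENNReal.ofReal_le_ofReal (by linarith)

/-- Strong duality, as an upper bound for the transport distance. -/
lemma Wsq_div_two_le (hΛ : AdmissibleMean Λ) (hMT : IsMarkovTriple Q pm) {μ0 μ1 : X → ℝ}
    (hμ0 : IsProb μ0) (hμ1 : IsProb μ1) {D : ℝ}
    (hD : ∀ φ : ℝ → X → ℝ, IsHJ Λ Q 1 φ → dotp (φ 1) μ1 - dotp (φ 0) μ0 ≤ D) :
    Wsq Λ Q μ0 μ1 / 2 ≤ ENNReal.ofReal D := by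
  obtain ⟨C, hC, hP⟩ := exists_poincare hMT
  have hle : ∀ ε ∈ Ioc (0 : ℝ) 1, Wsq Λ Q μ0 μ1 / 2 ≤ ENNReal.ofReal (D + (2 * C + 1) * ε) := by
    rintro ε ⟨h0, h1⟩
    obtain ⟨m, hm, hmp, hmle⟩ := exists_near_optimal_density hΛ hMT hμ0 hμ1 hD hC hP h0 h1
    refine (ENNReal.div_le_div_right (Wsq_le_of_density hΛ hMT hm hmp hmle) 2).trans_eq ?_
    rw [← ENNReal.ofReal_ofNat, ← ENNReal.ofReal_div_of_pos two_pos]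
    congr 1
    ring
  have hcont : Continuous fun ε : ℝ => ENNReal.ofReal (D + (2 * C + 1) * ε) :=
    ENNReal.continuous_ofReal.comp (by fun_prop)
  have hlim : Tendsto (fun ε : ℝ => ENNReal.ofReal (D + (2 * C + 1) * ε)) (𝓝[>] 0)
      (𝓝 (ENNReal.ofReal D)) := by
    simpa using (hcont.tendsto 0).mono_left nhdsWithin_le_nhds
  refine ge_of_tendsto hlim ?_
  filter_upwards [Ioc_mem_nhdsGT zero_lt_one] with ε hε using hle ε hε

end StrongDuality

end DiscreteTransport

/-- **Duality formula for the discrete transport distance** (Theorem 3.2):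
`(1/2) W(μ⁰, μ¹)² = sup { ⟨φ₁, μ¹⟩ − ⟨φ₀, μ⁰⟩ : φ ∈ C¹([0,1], ℝ^X) a Hamilton–Jacobi subsolution }`. -/
theorem duality_formula {X : Type*} [Fintype X] [DecidableEq X]
    (Λ : ℝ → ℝ → ℝ) (Q : X → X → ℝ) (pm : X → ℝ)
    (hMT : IsMarkovTriple Q pm) (hΛ : AdmissibleMean Λ)
    (μ0 μ1 : X → ℝ) (hμ0 : IsProb μ0) (hμ1 : IsProb μ1) :
    Wsq Λ Q μ0 μ1 / 2 =
      ENNReal.ofReal (sSup {d : ℝ | ∃ φ : ℝ → X → ℝ,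
        IsHJ Λ Q 1 φ ∧ d = dotp (φ 1) μ1 - dotp (φ 0) μ0}) := by
  obtain ⟨B, hB⟩ := DiscreteTransport.exists_dual_le hΛ hMT hμ0 hμ1
  have hne : {d : ℝ | ∃ φ : ℝ → X → ℝ,
      IsHJ Λ Q 1 φ ∧ d = dotp (φ 1) μ1 - dotp (φ 0) μ0}.Nonempty :=
    ⟨_, 0, DiscreteTransport.isHJ_zero, rfl⟩
  have hbdd : BddAbove {d : ℝ | ∃ φ : ℝ → X → ℝ,
      IsHJ Λ Q 1 φ ∧ d = dotp (φ 1) μ1 - dotp (φ 0) μ0} := by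
    refine ⟨B, ?_⟩
    rintro _ ⟨φ, hφ, rfl⟩
    exact hB φ hφ
  refine le_antisymm (DiscreteTransport.Wsq_div_two_le hΛ hMT hμ0 hμ1 fun φ hφ =>
    le_csSup hbdd ⟨φ, hφ, rfl⟩) ?_
  rw [ENNReal.le_div_iff_mul_le (by simp) (by simp)]
  refine le_iInf fun μ => le_iInf fun V => le_iInf fun hCE => ?_
  rw [← ENNReal.le_div_iff_mul_le (by simp) (by simp)]
  rcases eq_or_ne (curveAction Λ Q μ V / 2) ⊤ with htop | htop
  · rw [htop]
    exact le_top
  · rw [ENNReal.ofReal_le_iff_le_toReal htop]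
    refine csSup_le hne ?_
    rintro _ ⟨φ, hφ, rfl⟩
    exact (ENNReal.ofReal_le_iff_le_toReal htop).1
      (DiscreteTransport.ofReal_dual_le_curveAction hΛ hφ hCE)
end

section
/- Nonlocality on the triangle: let (X, Q, π) be a Markov triple with X = {1, 2, 3} and Q(x,y) > 0 for all x ≠ y, and let Λ be an admissible mean satisfying: Λ(s,t) → ∞ as t → ∞ for every s > 0, and also for s = 0 whenever Λ(0,t) > 0 for t > 0. If (μ, V) ∈ CE₁(δ₁, δ₂) is a minimiser, i.e. ∫₀¹ 𝒜(μ_t, V_t) dt = W(δ₁, δ₂)², where δ₁, δ₂ are the Dirac measures at 1 and 2, then there exists t ∈ (0,1) with μ_t(3) > 0. -/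
open MeasureTheory
open scoped ENNReal

section Nonlocality

namespace AdmissibleMean

variable {Λ : ℝ → ℝ → ℝ}

lemma mono₂ (hΛ : AdmissibleMean Λ) {s s' t t' : ℝ} (hs : 0 ≤ s) (hss : s ≤ s')
    (ht : 0 ≤ t) (htt : t ≤ t') : Λ s t ≤ Λ s' t' := by
  refine (hΛ.mono s s' t hs hss ht).trans ?_
  rw [hΛ.symm s' t, hΛ.symm s' t']
  exact hΛ.mono t t' s' ht htt (hs.trans hss)

lemma self (hΛ : AdmissibleMean Λ) {s : ℝ} (hs : 0 ≤ s) : Λ s s = s := by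
  have h := hΛ.homog s 1 1 hs zero_le_one zero_le_one
  rwa [mul_one, hΛ.normalized, mul_one] at h

lemma le_of_le (hΛ : AdmissibleMean Λ) {m s t : ℝ} (hm : 0 ≤ m) (hs : m ≤ s) (ht : m ≤ t) :
    m ≤ Λ s t :=
  (hΛ.self hm).symm.le.trans (hΛ.mono₂ hm hs hm ht)

lemma pos (hΛ : AdmissibleMean Λ) {s t : ℝ} (hs : 0 < s) (ht : 0 < t) : 0 < Λ s t :=
  (lt_min hs ht).trans_le (hΛ.le_of_le (lt_min hs ht).le (min_le_left s t) (min_le_right s t))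

/-- If `Λ(1, r) → ∞` as `r → ∞`, then `Λ(c, s)` has infinite slope in `s` at `s = 0`. -/
lemma exists_le_mul (hΛ : AdmissibleMean Λ)
    (htop : Filter.Tendsto (fun t => Λ 1 t) Filter.atTop Filter.atTop)
    {c η : ℝ} (hc : 0 < c) (hη : 0 < η) :
    ∃ δ > 0, ∀ s, 0 < s → s ≤ δ → s ≤ η * Λ c s := by
  obtain ⟨R, hR⟩ := Filter.eventually_atTop.1 (htop.eventually_ge_atTop (1 / η))
  have hR' : 0 < max R 1 := lt_max_of_lt_right one_pos
  refine ⟨c / max R 1, div_pos hc hR', fun s hs hsδ => ?_⟩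
  have hle : R ≤ c / s := by
    refine (le_max_left R 1).trans ?_
    rw [le_div_iff₀ hs]
    rw [le_div_iff₀ hR'] at hsδ
    linarith
  have h := hΛ.homog s 1 (c / s) hs.le zero_le_one (div_pos hc hs).le
  rw [mul_one, mul_div_cancel₀ _ hs.ne'] at h
  rw [hΛ.symm c s, h]
  have h1 := mul_le_mul_of_nonneg_left (hR _ hle) hη.le
  rw [mul_one_div_cancel hη.ne'] at h1
  nlinarith

end AdmissibleMean

section Integrand

variable {Λ : ℝ → ℝ → ℝ}

lemma Afun_of_pos {s t : ℝ} (hs : 0 < s) (ht : 0 < t) (w : ℝ) :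
    Afun Λ s t w = ENNReal.ofReal (w ^ 2 / Λ s t) := by
  simp [Afun, hs, ht]

lemma Afun_zero {s t : ℝ} (hs : 0 ≤ s) (ht : 0 ≤ t) : Afun Λ s t 0 = 0 := by
  unfold Afun
  split_ifs <;> simp_all

lemma Afun_eq_top {s t w : ℝ} (h : ¬ (0 < s ∧ 0 < t)) (hw : w ≠ 0) : Afun Λ s t w = ⊤ := by
  simp [Afun, h, hw]

lemma Afun_comm (hΛ : AdmissibleMean Λ) (s t w : ℝ) : Afun Λ s t w = Afun Λ t s w := by
  unfold Afun
  rw [hΛ.symm s t]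
  congr 1
  · exact propext and_comm
  · congr 1
    exact propext (and_congr_right fun _ => and_comm)

/-- The mean is bounded on bounded sets, hence the integrand is bounded below. -/
lemma le_Afun (hΛ : AdmissibleMean Λ) {s t q : ℝ} (hs : s ≤ q) (ht : t ≤ q) (w : ℝ) :
    ENNReal.ofReal (w ^ 2 / q) ≤ Afun Λ s t w := by
  by_cases h : 0 < s ∧ 0 < t
  · rw [Afun_of_pos h.1 h.2]
    refine ENNReal.ofReal_le_ofReal ?_
    refine div_le_div_of_nonneg_left (sq_nonneg w) (hΛ.pos h.1 h.2) ?_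
    exact (hΛ.mono₂ h.1.le hs h.2.le ht).trans_eq (hΛ.self (h.1.le.trans hs))
  · by_cases hw : w = 0
    · simp [hw]
    · simp [Afun_eq_top h hw]

lemma Afun_le_of_le (hΛ : AdmissibleMean Λ) {s t w m C : ℝ} (hm : 0 ≤ m) (hs : m ≤ s) (ht : m ≤ t)
    (hw : w ^ 2 ≤ C * m) : Afun Λ s t w ≤ ENNReal.ofReal C := by
  rcases eq_or_ne w 0 with rfl | hw0
  · rw [Afun_zero (hm.trans hs) (hm.trans ht)]
    exact zero_le
  · have hm' : 0 < m := by
      refine hm.lt_of_ne fun h => ?_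
      rw [← h, mul_zero] at hw
      exact absurd hw (not_le.2 (by positivity))
    have hl := hΛ.le_of_le hm hs ht
    rw [Afun_of_pos (hm'.trans_le hs) (hm'.trans_le ht)]
    refine ENNReal.ofReal_le_ofReal ((div_le_iff₀ (hm'.trans_le hl)).2 (hw.trans ?_))
    have hC : 0 ≤ C := by
      by_contra! hC
      nlinarith [sq_nonneg w]
    exact mul_le_mul_of_nonneg_left hl hC

/-- Mixing with a density carrying no flux scales the integrand down. -/
lemma Afun_mix_le (hΛ : AdmissibleMean Λ) {ε s t s' t' : ℝ} (hε : ε < 1) (hε0 : 0 ≤ ε)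
    (hs' : 0 ≤ s') (ht' : 0 ≤ t') (w : ℝ) :
    Afun Λ ((1 - ε) * s + ε * s') ((1 - ε) * t + ε * t') ((1 - ε) * w) ≤
      ENNReal.ofReal (1 - ε) * Afun Λ s t w := by
  have h1 : 0 < 1 - ε := by linarith
  have hes := mul_nonneg hε0 hs'
  have het := mul_nonneg hε0 ht'
  by_cases h : 0 < s ∧ 0 < t
  · obtain ⟨hs, ht⟩ := h
    have hs1 := mul_pos h1 hs
    have ht1 := mul_pos h1 ht
    rw [Afun_of_pos (by linarith) (by linarith), Afun_of_pos hs ht, ← ENNReal.ofReal_mul h1.le]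
    refine ENNReal.ofReal_le_ofReal ?_
    have hL : (1 - ε) * Λ s t ≤ Λ ((1 - ε) * s + ε * s') ((1 - ε) * t + ε * t') := by
      rw [← hΛ.homog _ _ _ h1.le hs.le ht.le]
      exact hΛ.mono₂ hs1.le (by linarith) ht1.le (by linarith)
    have hp := hΛ.pos hs ht
    calc ((1 - ε) * w) ^ 2 / Λ ((1 - ε) * s + ε * s') ((1 - ε) * t + ε * t')
        ≤ ((1 - ε) * w) ^ 2 / ((1 - ε) * Λ s t) :=
          div_le_div_of_nonneg_left (sq_nonneg _) (mul_pos h1 hp) hL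
      _ = (1 - ε) * (w ^ 2 / Λ s t) := by field_simp
  · by_cases hw : w = 0 ∧ 0 ≤ s ∧ 0 ≤ t
    · obtain ⟨rfl, hs, ht⟩ := hw
      have := mul_nonneg h1.le hs
      have := mul_nonneg h1.le ht
      rw [mul_zero, Afun_zero (by linarith) (by linarith)]
      exact zero_le
    · have : Afun Λ s t w = ⊤ := by simp only [Afun, if_neg h, if_neg hw]
      rw [this, ENNReal.mul_top (by simpa using hε)]
      exact le_top

/-- Opening an edge towards an empty vertex: sending a small flux `ε * u` together with a small
mass `ε * p` costs `o(ε)`. -/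
lemma Afun_open_le (hΛ : AdmissibleMean Λ) {ε m n p v u q q₁ q₂ C η : ℝ}
    (hε : 0 < ε) (hε' : ε ≤ 1 / 2) (hn : 0 ≤ n) (hp : 0 ≤ p) (hp1 : p ≤ 1)
    (hq : 0 < q) (hq₁ : q ≤ q₁) (hq₂ : q ≤ q₂) (hη : 0 ≤ η) (hC : 0 ≤ C)
    (hslope : ∀ s, 0 < s → s ≤ ε * q → s ≤ η * Λ (q / 4) s)
    (hu : u ≠ 0 → 1 / 2 ≤ m) (hup : u ^ 2 ≤ C * p) :
    Afun Λ (((1 - ε) * m + ε * n) * q₁) (((1 - ε) * 0 + ε * p) * q₂) ((1 - ε) * v + ε * u) ≤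
      ENNReal.ofReal (1 - ε) * Afun Λ (m * q₁) (0 * q₂) v + ENNReal.ofReal (ε * (C * η / q)) := by
  rcases eq_or_ne u 0 with rfl | hu0
  · refine le_add_right ?_
    have h := Afun_mix_le hΛ (s := m * q₁) (t := 0 * q₂) (by linarith : ε < 1) hε.le
      (mul_nonneg hn (hq.le.trans hq₁)) (mul_nonneg hp (hq.le.trans hq₂)) v
    rw [mul_zero ε, add_zero]
    rwa [← mul_assoc, ← mul_assoc, ← mul_assoc, ← mul_assoc, ← add_mul, ← add_mul] at h
  rcases eq_or_ne v 0 with rfl | hv0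
  · refine le_add_left ?_
    have hm := hu hu0
    have hp' : 0 < p := by
      refine hp.lt_of_ne fun h => ?_
      rw [← h, mul_zero] at hup
      exact absurd hup (not_le.2 (by positivity))
    have hs : 0 < ε * p * q := by positivity
    have h1 : q / 4 ≤ ((1 - ε) * m + ε * n) * q₁ := by
      have : 1 / 4 ≤ (1 - ε) * m + ε * n := by
        nlinarith [mul_nonneg hε.le hn]
      nlinarith
    have h2 : ε * p * q ≤ ((1 - ε) * 0 + ε * p) * q₂ := by
      rw [mul_zero, zero_add]
      exact mul_le_mul_of_nonneg_left hq₂ (by positivity)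
    have hsl := hslope _ hs (by nlinarith [mul_pos hε hq])
    have hL := hΛ.mono₂ (by positivity : 0 ≤ q / 4) h1 hs.le h2
    have hL0 := hΛ.pos (by positivity : 0 < q / 4) hs
    rw [Afun_of_pos (by linarith) (by linarith)]
    refine ENNReal.ofReal_le_ofReal ?_
    simp only [mul_zero, zero_add] at hL ⊢
    rw [div_le_iff₀ (hL0.trans_le hL)]
    calc (ε * u) ^ 2 = ε ^ 2 * u ^ 2 := by ring
      _ ≤ ε ^ 2 * (C * p) := mul_le_mul_of_nonneg_left hup (sq_nonneg ε)
      _ = ε * C / q * (ε * p * q) := by field_simp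
      _ ≤ ε * C / q * (η * Λ (q / 4) (ε * p * q)) :=
          mul_le_mul_of_nonneg_left hsl (by positivity)
      _ = ε * (C * η / q) * Λ (q / 4) (ε * p * q) := by ring
      _ ≤ _ := mul_le_mul_of_nonneg_left hL (by positivity)
  · rw [Afun_eq_top (by simp) hv0, ENNReal.mul_top (by simpa using (by linarith : ε < 1)),
      top_add]
    exact le_top

end Integrand

section Ramp

/-- The projection of the real line onto `[0, 1]`. -/
noncomputable def clampUnit (s : ℝ) : ℝ := max 0 (min 1 s)

/-- A monotone `C¹` transition from `0` to `1`. -/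
noncomputable def ramp (s : ℝ) : ℝ := 3 * clampUnit s ^ 2 - 2 * clampUnit s ^ 3

/-- The derivative of `ramp`. -/
noncomputable def rampDeriv (s : ℝ) : ℝ := 6 * clampUnit s * (1 - clampUnit s)

lemma clampUnit_nonneg (s : ℝ) : 0 ≤ clampUnit s := le_max_left _ _

lemma clampUnit_le_one (s : ℝ) : clampUnit s ≤ 1 := max_le zero_le_one (min_le_left _ _)

lemma clampUnit_of_nonpos {s : ℝ} (h : s ≤ 0) : clampUnit s = 0 :=
  max_eq_left ((min_le_right _ _).trans h)

lemma clampUnit_of_one_le {s : ℝ} (h : 1 ≤ s) : clampUnit s = 1 := by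
  simp [clampUnit, h]

lemma clampUnit_of_mem {s : ℝ} (h0 : 0 ≤ s) (h1 : s ≤ 1) : clampUnit s = s := by
  simp [clampUnit, h0, h1]

@[fun_prop]
lemma continuous_clampUnit : Continuous clampUnit := by
  unfold clampUnit
  fun_prop

@[fun_prop]
lemma continuous_ramp : Continuous ramp := by
  unfold ramp
  fun_prop

@[fun_prop]
lemma continuous_rampDeriv : Continuous rampDeriv := by
  unfold rampDeriv
  fun_prop

lemma ramp_of_nonpos {s : ℝ} (h : s ≤ 0) : ramp s = 0 := by
  simp [ramp, clampUnit_of_nonpos h]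

lemma ramp_of_one_le {s : ℝ} (h : 1 ≤ s) : ramp s = 1 := by
  rw [ramp, clampUnit_of_one_le h]
  norm_num

lemma rampDeriv_of_nonpos {s : ℝ} (h : s ≤ 0) : rampDeriv s = 0 := by
  simp [rampDeriv, clampUnit_of_nonpos h]

lemma rampDeriv_of_one_le {s : ℝ} (h : 1 ≤ s) : rampDeriv s = 0 := by
  simp [rampDeriv, clampUnit_of_one_le h]

lemma ramp_nonneg (s : ℝ) : 0 ≤ ramp s := by
  have h0 := clampUnit_nonneg s
  have h1 := clampUnit_le_one s
  unfold ramp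
  nlinarith [mul_nonneg (sq_nonneg (clampUnit s)) (sub_nonneg.2 h1), sq_nonneg (clampUnit s)]

lemma rampDeriv_sq_le (s : ℝ) : rampDeriv s ^ 2 ≤ 36 * ramp s := by
  have h0 := clampUnit_nonneg s
  have h1 := clampUnit_le_one s
  have h2 : (1 - clampUnit s) ^ 2 ≤ 3 - 2 * clampUnit s := by nlinarith
  have := mul_le_mul_of_nonneg_left h2 (sq_nonneg (clampUnit s))
  unfold ramp rampDeriv
  nlinarith

lemma rampDeriv_sq_le' (s : ℝ) : rampDeriv s ^ 2 ≤ 36 * (1 - ramp s) := by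
  have h0 := clampUnit_nonneg s
  have h1 := clampUnit_le_one s
  have h2 : clampUnit s ^ 2 ≤ 1 + 2 * clampUnit s := by nlinarith
  have := mul_le_mul_of_nonneg_left h2 (sq_nonneg (1 - clampUnit s))
  unfold ramp rampDeriv
  nlinarith

lemma ramp_le_one (s : ℝ) : ramp s ≤ 1 := by
  nlinarith [rampDeriv_sq_le' s, sq_nonneg (rampDeriv s)]

lemma hasDerivAt_ramp {s : ℝ} (h0 : s ≠ 0) (h1 : s ≠ 1) : HasDerivAt ramp (rampDeriv s) s := by
  rcases lt_or_gt_of_ne h0 with h | h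
  · rw [rampDeriv_of_nonpos h.le]
    refine (hasDerivAt_const s (0 : ℝ)).congr_of_eventuallyEq ?_
    filter_upwards [Iio_mem_nhds h] with r hr using ramp_of_nonpos (le_of_lt hr)
  rcases lt_or_gt_of_ne h1 with h' | h'
  · have hd : HasDerivAt (fun r : ℝ => 3 * r ^ 2 - 2 * r ^ 3) (rampDeriv s) s := by
      have := ((hasDerivAt_pow 2 s).const_mul 3).sub ((hasDerivAt_pow 3 s).const_mul 2)
      refine this.congr_deriv ?_
      rw [rampDeriv, clampUnit_of_mem h.le h'.le]
      norm_num
      ring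
    refine hd.congr_of_eventuallyEq ?_
    filter_upwards [Ioo_mem_nhds h h'] with r hr
    rw [ramp, clampUnit_of_mem hr.1.le hr.2.le]
  · rw [rampDeriv_of_one_le h'.le]
    refine (hasDerivAt_const s (1 : ℝ)).congr_of_eventuallyEq ?_
    filter_upwards [Ioi_mem_nhds h'] with r hr using ramp_of_one_le (le_of_lt hr)

lemma integral_rampDeriv (a b : ℝ) : ∫ s in a..b, rampDeriv s = ramp b - ramp a := by
  refine integral_eq_of_hasDerivAt_off_countable ramp rampDeriv
    (Set.toFinite ({0, 1} : Set ℝ)).countable continuous_ramp.continuousOn (fun x hx => ?_)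
    (continuous_rampDeriv.intervalIntegrable a b)
  have : x ≠ 0 ∧ x ≠ 1 := by simpa using hx.2
  exact hasDerivAt_ramp this.1 this.2

lemma integral_rampDeriv_affine (k d t : ℝ) :
    ∫ s in (0 : ℝ)..t, k * rampDeriv (k * s + d) = ramp (k * t + d) - ramp d := by
  rw [intervalIntegral.integral_const_mul, intervalIntegral.mul_integral_comp_mul_add,
    integral_rampDeriv, mul_zero, zero_add]

end Ramp

section Curves

/-- Convex combinations of solutions of the continuity equation are solutions. -/
lemma IsCE1.mix {X : Type*} [Fintype X] {μ0 μ1 : X → ℝ} {μ ν : ℝ → X → ℝ} {V U : ℝ → X → X → ℝ}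
    (h : IsCE1 μ0 μ1 μ V) (h' : IsCE1 μ0 μ1 ν U) {ε : ℝ} (hε0 : 0 ≤ ε) (hε1 : ε ≤ 1) :
    IsCE1 μ0 μ1 (fun t x => (1 - ε) * μ t x + ε * ν t x)
      (fun t x y => (1 - ε) * V t x y + ε * U t x y) := by
  obtain ⟨hc, hi, hp, h0, h1, he⟩ := h
  obtain ⟨hc', hi', hp', h0', h1', he'⟩ := h'
  have hε2 : 0 ≤ 1 - ε := sub_nonneg.2 hε1
  refine ⟨fun x => ((hc x).const_mul _).add ((hc' x).const_mul _),
    fun x y => ((hi x y).const_mul _).add ((hi' x y).const_mul _), fun t ht => ⟨fun x => ?_, ?_⟩,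
    ?_, ?_, fun x t ht => ?_⟩
  · exact add_nonneg (mul_nonneg hε2 ((hp t ht).1 x)) (mul_nonneg hε0 ((hp' t ht).1 x))
  · rw [Finset.sum_add_distrib, ← Finset.mul_sum, ← Finset.mul_sum, (hp t ht).2, (hp' t ht).2]
    ring
  · funext x
    simp only [h0, h0']
    ring
  · funext x
    simp only [h1, h1']
    ring
  · have hsub : Set.uIcc 0 t ⊆ Set.uIcc (0 : ℝ) 1 := by
      rw [Set.uIcc_of_le ht.1, Set.uIcc_of_le zero_le_one]
      exact Set.Icc_subset_Icc_right ht.2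
    have hhalf : ∀ {Z : ℝ → X → X → ℝ}, (∀ x y, IntervalIntegrable (fun s => Z s x y) volume 0 1) →
        IntervalIntegrable (fun s => (1 / 2 : ℝ) * ∑ y, (Z s x y - Z s y x)) volume 0 t := by
      intro Z hZ
      refine IntervalIntegrable.const_mul ?_ _
      have := IntervalIntegrable.sum Finset.univ
        (fun y _ => ((hZ x y).mono_set hsub).sub ((hZ y x).mono_set hsub))
      refine this.congr fun s _ => ?_
      simp
    have : (fun s => (1 / 2 : ℝ) * ∑ y, ((1 - ε) * V s x y + ε * U s x y -
          ((1 - ε) * V s y x + ε * U s y x))) =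
        fun s => (1 - ε) * ((1 / 2 : ℝ) * ∑ y, (V s x y - V s y x)) +
          ε * ((1 / 2 : ℝ) * ∑ y, (U s x y - U s y x)) := by
      funext s
      simp only [Finset.mul_sum, ← Finset.sum_add_distrib]
      exact Finset.sum_congr rfl fun y _ => by ring
    simp only [this]
    rw [intervalIntegral.integral_add ((hhalf hi).const_mul _) ((hhalf hi').const_mul _),
      intervalIntegral.integral_const_mul (1 - ε), intervalIntegral.integral_const_mul ε,
      he x t ht, he' x t ht]
    ring

/-- The curve moving all mass from `0` to `2` during `[0, 1/k]`, and from `2` to `1` during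
`[1 - 1/k, 1]`. -/
noncomputable def detour (k t : ℝ) : Fin 3 → ℝ :=
  ![1 - ramp (k * t), ramp (k * t + (1 - k)), ramp (k * t) - ramp (k * t + (1 - k))]

/-- The flux of `detour`. -/
noncomputable def detourFlux (k t : ℝ) : Fin 3 → Fin 3 → ℝ :=
  ![![0, 0, 2 * (k * rampDeriv (k * t))], ![0, 0, 0],
    ![0, 2 * (k * rampDeriv (k * t + (1 - k))), 0]]

lemma detour_cases {k : ℝ} (hk : 2 ≤ k) (t : ℝ) :
    k * t + (1 - k) ≤ 0 ∨ 1 ≤ k * t := by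
  rcases le_total t (1 / 2) with h | h
  · left; nlinarith
  · right; nlinarith

lemma detour_nonneg {k : ℝ} (hk : 2 ≤ k) (t : ℝ) (x : Fin 3) : 0 ≤ detour k t x := by
  fin_cases x
  · simpa [detour] using ramp_le_one _
  · simpa [detour] using ramp_nonneg _
  · rcases detour_cases hk t with h | h
    · simpa [detour, ramp_of_nonpos h] using ramp_nonneg _
    · simpa [detour, ramp_of_one_le h] using ramp_le_one _

lemma isCE1_detour {k : ℝ} (hk : 2 ≤ k) :
    IsCE1 (fun x : Fin 3 => if x = 0 then 1 else 0) (fun x => if x = 1 then 1 else 0)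
      (detour k) (detourFlux k) := by
  have hk0 : ramp (1 - k) = 0 := ramp_of_nonpos (by linarith)
  have hI1 : ∀ t, ∫ s in (0 : ℝ)..t, k * rampDeriv (k * s) = ramp (k * t) := fun t => by
    simpa [ramp_of_nonpos le_rfl] using integral_rampDeriv_affine k 0 t
  have hI2 : ∀ t, ∫ s in (0 : ℝ)..t, k * rampDeriv (k * s + (1 - k)) =
      ramp (k * t + (1 - k)) := fun t => by
    rw [integral_rampDeriv_affine, hk0, sub_zero]
  refine ⟨fun x => ?_, fun x y => ?_, fun t _ => ⟨detour_nonneg hk t, ?_⟩, ?_, ?_, fun x t _ => ?_⟩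
  · apply Continuous.continuousOn
    fin_cases x <;> simp [detour] <;> fun_prop
  · apply Continuous.intervalIntegrable
    fin_cases x <;> fin_cases y <;> simp [detourFlux] <;> fun_prop
  · simp [detour, Fin.sum_univ_three]
  · funext x
    fin_cases x <;> simp [detour, ramp_of_nonpos le_rfl, hk0]
  · funext x
    have : ramp k = 1 := ramp_of_one_le (by linarith)
    fin_cases x <;> simp [detour, this, ramp_of_one_le le_rfl]
  · fin_cases x
    · simp [detour, detourFlux, Fin.sum_univ_three, hI1]
    · simp [detour, detourFlux, Fin.sum_univ_three, hI2]
    · have : ∀ s, (1 / 2 : ℝ) * ∑ y, (detourFlux k s 2 y - detourFlux k s y 2) =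
          k * rampDeriv (k * s + (1 - k)) - k * rampDeriv (k * s) := fun s => by
        simp [detourFlux, Fin.sum_univ_three]
        ring
      simp only [Fin.reduceFinMk, this]
      rw [intervalIntegral.integral_sub, hI1, hI2]
      · simp [detour]
      · exact Continuous.intervalIntegrable (by fun_prop) _ _
      · exact Continuous.intervalIntegrable (by fun_prop) _ _

/-- A nonconstant curve has positive action. -/
lemma curveAction_ne_zero {X : Type*} [Fintype X] {Λ : ℝ → ℝ → ℝ} (hΛ : AdmissibleMean Λ)
    {Q : X → X → ℝ} (hQ : ∀ x y, 0 ≤ Q x y) {μ0 μ1 : X → ℝ} (hne : μ0 ≠ μ1)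
    {μ : ℝ → X → ℝ} {V : ℝ → X → X → ℝ} (h : IsCE1 μ0 μ1 μ V) : curveAction Λ Q μ V ≠ 0 := by
  intro hzero
  obtain ⟨-, hi, hp, h0, h1, he⟩ := h
  obtain ⟨q, hq, hQq⟩ : ∃ q : ℝ, 0 < q ∧ ∀ x y, Q x y ≤ q := by
    refine ⟨1 + ∑ x, ∑ y, Q x y,
      add_pos_of_pos_of_nonneg one_pos (Finset.sum_nonneg fun x _ =>
        Finset.sum_nonneg fun y _ => hQ x y), fun x y => ?_⟩
    have h1 := Finset.single_le_sum (fun y _ => hQ x y) (Finset.mem_univ y)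
    have h2 := Finset.single_le_sum (f := fun x => ∑ y, Q x y)
      (fun x _ => Finset.sum_nonneg fun y _ => hQ x y) (Finset.mem_univ x)
    linarith
  have hmass : ∀ t ∈ Set.Icc (0 : ℝ) 1, ∀ x y, μ t x * Q x y ≤ q := fun t ht x y => by
    have hx1 : μ t x ≤ 1 := by
      rw [← (hp t ht).2]
      exact Finset.single_le_sum (fun x _ => (hp t ht).1 x) (Finset.mem_univ x)
    exact (mul_le_of_le_one_left (hQ x y) hx1).trans (hQq x y)
  have hae : ∀ x y, ∀ᵐ s ∂volume.restrict (Set.Ioc (0 : ℝ) 1), V s x y = 0 := fun x y => by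
    have hm : AEMeasurable (fun s => ENNReal.ofReal (V s x y ^ 2 / q) / 2)
        (volume.restrict (Set.Ioc (0 : ℝ) 1)) :=
      (((hi x y).1.aestronglyMeasurable.aemeasurable.pow_const 2).div_const q).ennreal_ofReal.div_const
        2
    have hle : ∫⁻ s in Set.Ioc (0 : ℝ) 1, ENNReal.ofReal (V s x y ^ 2 / q) / 2 ≤
        curveAction Λ Q μ V := by
      refine (lintegral_mono_set Set.Ioc_subset_Icc_self).trans
        (setLIntegral_mono' measurableSet_Icc fun t ht => ENNReal.div_le_div_right ?_ 2)
      refine (le_Afun hΛ (hmass t ht x y) (hmass t ht y x) (V t x y)).trans ?_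
      refine le_trans ?_ (Finset.single_le_sum (f := fun x => ∑ y, Afun Λ (μ t x * Q x y)
        (μ t y * Q y x) (V t x y)) (fun _ _ => zero_le) (Finset.mem_univ x))
      exact Finset.single_le_sum (f := fun y => Afun Λ (μ t x * Q x y)
        (μ t y * Q y x) (V t x y)) (fun _ _ => zero_le) (Finset.mem_univ y)
    rw [hzero, nonpos_iff_eq_zero, lintegral_eq_zero_iff' hm] at hle
    filter_upwards [hle] with s hs
    by_contra hV
    have : 0 < V s x y ^ 2 / q := by positivity
    simp at hs
    linarith
  refine hne (funext fun x => ?_)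
  have hx := he x 1 (Set.right_mem_Icc.2 zero_le_one)
  have hI : ∫ s in (0 : ℝ)..1, (1 / 2 : ℝ) * ∑ y, (V s x y - V s y x) = 0 := by
    rw [intervalIntegral.integral_of_le zero_le_one]
    refine integral_eq_zero_of_ae ?_
    filter_upwards [ae_all_iff.2 fun y => hae x y, ae_all_iff.2 fun y => hae y x] with s hs hs'
    simp [hs, hs']
  rw [h1, hI, sub_zero] at hx
  exact hx.symm

lemma curveAction_detour_ne_top {Λ : ℝ → ℝ → ℝ} (hΛ : AdmissibleMean Λ) {Q : Fin 3 → Fin 3 → ℝ}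
    {q : ℝ} (hq : 0 < q) (hqQ : ∀ x y, x ≠ y → q ≤ Q x y) (hQ : ∀ x y, 0 ≤ Q x y) :
    curveAction Λ Q (detour 2) (detourFlux 2) ≠ ⊤ := by
  have hedge : ∀ {s t q₁ q₂ r : ℝ}, 0 ≤ s → 0 ≤ t → q ≤ q₁ → q ≤ q₂ → r ^ 2 ≤ 36 * s →
      r ^ 2 ≤ 36 * t →
      Afun Λ (s * q₁) (t * q₂) (2 * (2 * r)) ≤ ENNReal.ofReal (576 / q) := by
    intro s t q₁ q₂ r hs ht h₁ h₂ hrs hrt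
    have hm : 0 ≤ min s t := le_min hs ht
    refine Afun_le_of_le hΛ (m := min s t * q) (by positivity)
      (mul_le_mul (min_le_left s t) h₁ hq.le hs) (mul_le_mul (min_le_right s t) h₂ hq.le ht) ?_
    have hr : r ^ 2 ≤ 36 * min s t := by
      rcases min_choice s t with h | h <;> rw [h] <;> assumption
    calc (2 * (2 * r)) ^ 2 = 16 * r ^ 2 := by ring
      _ ≤ 576 * min s t := by linarith
      _ = 576 / q * (min s t * q) := by field_simp
  have hpair : ∀ t x y, Afun Λ (detour 2 t x * Q x y) (detour 2 t y * Q y x)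
      (detourFlux 2 t x y) ≤ ENNReal.ofReal (576 / q) := by
    intro t x y
    have hx := detour_nonneg le_rfl t x
    have hy := detour_nonneg le_rfl t y
    by_cases hw : detourFlux 2 t x y = 0
    · rw [hw, Afun_zero (mul_nonneg hx (hQ x y)) (mul_nonneg hy (hQ y x))]
      exact zero_le
    fin_cases x <;> fin_cases y <;> first | exact absurd rfl hw | skip
    · refine hedge hx hy (hqQ _ _ (by decide)) (hqQ _ _ (by decide)) (rampDeriv_sq_le' _) ?_
      rcases detour_cases le_rfl t with h | h
      · simpa [detour, ramp_of_nonpos h] using rampDeriv_sq_le (2 * t)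
      · simp [detourFlux, rampDeriv_of_one_le h] at hw
    · refine hedge hx hy (hqQ _ _ (by decide)) (hqQ _ _ (by decide)) ?_ (rampDeriv_sq_le _)
      rcases detour_cases le_rfl t with h | h
      · simp [detourFlux, rampDeriv_of_nonpos h] at hw
      · simpa [detour, ramp_of_one_le h] using rampDeriv_sq_le' (2 * t + (1 - 2))
  have hact : ∀ t, action Λ Q (detour 2 t) (detourFlux 2 t) ≤
      (9 * ENNReal.ofReal (576 / q)) / 2 := by
    intro t
    refine ENNReal.div_le_div_right ((Finset.sum_le_sum fun x _ =>
      Finset.sum_le_sum fun y _ => hpair t x y).trans ?_) 2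
    simp only [Finset.sum_const, Finset.card_univ, Fintype.card_fin, smul_smul]
    rw [nsmul_eq_mul]
    norm_num
  refine ne_top_of_le_ne_top ?_ (lintegral_mono fun t => hact t)
  rw [setLIntegral_const]
  exact ENNReal.mul_ne_top (ENNReal.div_ne_top (ENNReal.mul_ne_top (by simp) (by simp)) (by simp))
    (by simp)

/-- Mixing a curve that avoids the vertex `2` with a detour through `2` decreases the action
to first order. -/
lemma curveAction_mix_le {Λ : ℝ → ℝ → ℝ} (hΛ : AdmissibleMean Λ) {Q : Fin 3 → Fin 3 → ℝ}
    {q : ℝ} (hq : 0 < q) (hqQ : ∀ x y, x ≠ y → q ≤ Q x y) (hQ : ∀ x y, 0 ≤ Q x y)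
    {μ : ℝ → Fin 3 → ℝ} {V : ℝ → Fin 3 → Fin 3 → ℝ} {k ε η : ℝ} (hk : 2 ≤ k)
    (h0 : ∀ t ∈ Set.Icc (0 : ℝ) 1, k * t < 1 → 1 / 2 ≤ μ t 0)
    (h1 : ∀ t ∈ Set.Icc (0 : ℝ) 1, 0 < k * t + (1 - k) → 1 / 2 ≤ μ t 1)
    (h2 : ∀ t ∈ Set.Icc (0 : ℝ) 1, μ t 2 = 0)
    (hε : 0 < ε) (hε' : ε ≤ 1 / 2) (hη : 0 ≤ η)
    (hslope : ∀ s, 0 < s → s ≤ ε * q → s ≤ η * Λ (q / 4) s) :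
    curveAction Λ Q (fun t x => (1 - ε) * μ t x + ε * detour k t x)
      (fun t x y => (1 - ε) * V t x y + ε * detourFlux k t x y) ≤
      ENNReal.ofReal (1 - ε) * curveAction Λ Q μ V +
        ENNReal.ofReal (9 * (ε * (144 * k ^ 2 * η / q))) := by
  set e : ℝ≥0∞ := ENNReal.ofReal (ε * (144 * k ^ 2 * η / q)) with he
  have hpair : ∀ t ∈ Set.Icc (0 : ℝ) 1, ∀ x y,
      Afun Λ (((1 - ε) * μ t x + ε * detour k t x) * Q x y)
        (((1 - ε) * μ t y + ε * detour k t y) * Q y x)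
        ((1 - ε) * V t x y + ε * detourFlux k t x y) ≤
      ENNReal.ofReal (1 - ε) * Afun Λ (μ t x * Q x y) (μ t y * Q y x) (V t x y) + e := by
    intro t ht x y
    have hx := detour_nonneg hk t
    have hle : detour k t 2 ≤ 1 := by
      have h3 : ∑ x, detour k t x = 1 := by simp [detour, Fin.sum_univ_three]
      rw [← h3]
      exact Finset.single_le_sum (fun x _ => hx x) (Finset.mem_univ 2)
    have hC : 0 ≤ 144 * k ^ 2 := by positivity
    by_cases hw : detourFlux k t x y = 0
    · refine le_add_right ?_
      have h := Afun_mix_le hΛ (s := μ t x * Q x y) (t := μ t y * Q y x)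
        (by linarith : ε < 1) hε.le
        (mul_nonneg (hx x) (hQ x y)) (mul_nonneg (hx y) (hQ y x)) (V t x y)
      rw [hw, mul_zero ε, add_zero]
      rwa [← mul_assoc, ← mul_assoc, ← mul_assoc, ← mul_assoc, ← add_mul, ← add_mul] at h
    fin_cases x <;> fin_cases y <;> first | exact absurd rfl hw | skip
    · have hkt : k * t < 1 := by
        by_contra! h
        simp [detourFlux, rampDeriv_of_one_le h] at hw
      have hup : detourFlux k t 0 2 ^ 2 ≤ 144 * k ^ 2 * detour k t 2 := by
        have hb := (detour_cases hk t).resolve_right (not_le.2 hkt)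
        have := mul_le_mul_of_nonneg_left (rampDeriv_sq_le (k * t)) (sq_nonneg (2 * k))
        simp only [detour, detourFlux, Matrix.cons_val, ramp_of_nonpos hb]
        linarith
      have := Afun_open_le hΛ (v := V t 0 2) hε hε' (hx 0) (hx 2) hle hq
        (hqQ 0 2 (by decide)) (hqQ 2 0 (by decide)) hη hC hslope
        (fun _ => h0 t ht hkt) hup
      rw [← h2 t ht] at this
      exact this
    · have hkt : 0 < k * t + (1 - k) := by
        by_contra! h
        simp [detourFlux, rampDeriv_of_nonpos h] at hw
      have hup : detourFlux k t 2 1 ^ 2 ≤ 144 * k ^ 2 * detour k t 2 := by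
        have hb := (detour_cases hk t).resolve_left (not_le.2 hkt)
        have := mul_le_mul_of_nonneg_left (rampDeriv_sq_le' (k * t + (1 - k)))
          (sq_nonneg (2 * k))
        simp only [detour, detourFlux, Matrix.cons_val, ramp_of_one_le hb]
        linarith
      have := Afun_open_le hΛ (v := V t 2 1) hε hε' (hx 1) (hx 2) hle hq
        (hqQ 1 2 (by decide)) (hqQ 2 1 (by decide)) hη hC hslope
        (fun _ => h1 t ht hkt) hup
      rw [← h2 t ht, Afun_comm hΛ, Afun_comm hΛ (μ t 1 * Q 1 2)] at this
      exact this
  have hact : ∀ t ∈ Set.Icc (0 : ℝ) 1,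
      action Λ Q (fun x => (1 - ε) * μ t x + ε * detour k t x)
        (fun x y => (1 - ε) * V t x y + ε * detourFlux k t x y) ≤
      ENNReal.ofReal (1 - ε) * action Λ Q (μ t) (V t) + 9 * e := by
    intro t ht
    refine (ENNReal.div_le_div_right (Finset.sum_le_sum fun x _ =>
      Finset.sum_le_sum fun y _ => hpair t ht x y) 2).trans ?_
    simp only [Finset.sum_add_distrib, ← Finset.mul_sum, Finset.sum_const, Finset.card_univ,
      Fintype.card_fin, smul_smul]
    rw [ENNReal.add_div, mul_div_assoc, nsmul_eq_mul]
    refine add_le_add le_rfl ((ENNReal.div_le_of_le_mul ?_))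
    norm_num
    exact le_mul_of_one_le_right zero_le (by norm_num)
  refine (setLIntegral_mono' measurableSet_Icc hact).trans ?_
  rw [lintegral_add_right _ measurable_const, lintegral_const_mul' _ _ ENNReal.ofReal_ne_top,
    setLIntegral_const]
  refine add_le_add le_rfl ?_
  rw [ENNReal.ofReal_mul (by norm_num : (0 : ℝ) ≤ 9)]
  simp [he]

/-- Near the endpoints, a continuous curve between `0` and `1` keeps half of its mass there. -/
lemma IsCE1.exists_two_le {μ : ℝ → Fin 3 → ℝ} {V : ℝ → Fin 3 → Fin 3 → ℝ}
    (h : IsCE1 (fun x : Fin 3 => if x = 0 then 1 else 0) (fun x => if x = 1 then 1 else 0) μ V) :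
    ∃ k : ℝ, 2 ≤ k ∧ (∀ t ∈ Set.Icc (0 : ℝ) 1, k * t < 1 → 1 / 2 ≤ μ t 0) ∧
      (∀ t ∈ Set.Icc (0 : ℝ) 1, 0 < k * t + (1 - k) → 1 / 2 ≤ μ t 1) := by
  obtain ⟨hc, -, -, h0, h1, -⟩ := h
  have hev0 : ∀ᶠ t in nhdsWithin 0 (Set.Icc (0 : ℝ) 1), 1 / 2 < μ t 0 := by
    refine (hc 0 0 (by simp)).eventually (lt_mem_nhds ?_)
    norm_num [h0]
  have hev1 : ∀ᶠ t in nhdsWithin 1 (Set.Icc (0 : ℝ) 1), 1 / 2 < μ t 1 := by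
    refine (hc 1 1 (by simp)).eventually (lt_mem_nhds ?_)
    norm_num [h1]
  obtain ⟨r, hr, hr0⟩ := Metric.mem_nhdsWithin_iff.1 hev0
  obtain ⟨r', hr', hr1⟩ := Metric.mem_nhdsWithin_iff.1 hev1
  refine ⟨max 2 (max (1 / r) (1 / r')), le_max_left _ _, fun t ht hkt => ?_, fun t ht hkt => ?_⟩
  · have hk : 1 / r ≤ max 2 (max (1 / r) (1 / r')) :=
      (le_max_left _ _).trans (le_max_right _ _)
    refine (hr0 ⟨?_, ht⟩ : 1 / 2 < μ t 0).le
    have hlt : 1 / r * t < 1 := (mul_le_mul_of_nonneg_right hk ht.1).trans_lt hkt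
    rw [Metric.mem_ball, Real.dist_eq, sub_zero, abs_of_nonneg ht.1]
    rw [one_div_mul_eq_div, div_lt_one hr] at hlt
    exact hlt
  · have hk : 1 / r' ≤ max 2 (max (1 / r) (1 / r')) :=
      (le_max_right _ _).trans (le_max_right _ _)
    refine (hr1 ⟨?_, ht⟩ : 1 / 2 < μ t 1).le
    have ht' := sub_nonneg.2 ht.2
    have hlt : 1 / r' * (1 - t) < 1 := by
      have := mul_le_mul_of_nonneg_right hk ht'
      linarith
    rw [Metric.mem_ball, Real.dist_eq, abs_sub_comm, abs_of_nonneg ht']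
    rw [one_div_mul_eq_div, div_lt_one hr'] at hlt
    exact hlt

end Curves

end Nonlocality

/-- **Nonlocality of optimal transport on the triangle** (Theorem 6.3): on the three-point
space with all rates positive, and for an admissible mean satisfying Assumption 6.1, every
action-minimising solution of the continuity equation joining the Dirac measures at the two
points `0` and `1` gives positive mass to the third point `2` at some time `t ∈ (0,1)`.
(The points `1, 2, 3` of the paper are identified with `0, 1, 2 : Fin 3`.) -/
theorem triangle_nonlocality
    (Λ : ℝ → ℝ → ℝ) (hΛ : AdmissibleMean Λ)
    (hΛtop : ∀ s : ℝ, 0 < s → Filter.Tendsto (fun t => Λ s t) Filter.atTop Filter.atTop)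
    (hΛzero : (∀ t : ℝ, 0 < t → 0 < Λ 0 t) →
      Filter.Tendsto (fun t => Λ 0 t) Filter.atTop Filter.atTop)
    (Q : Fin 3 → Fin 3 → ℝ) (pm : Fin 3 → ℝ)
    (hMT : IsMarkovTriple Q pm)
    (hQpos : ∀ x y : Fin 3, x ≠ y → 0 < Q x y)
    (μ : ℝ → Fin 3 → ℝ) (V : ℝ → Fin 3 → Fin 3 → ℝ)
    (hCE : IsCE1 (fun x => if x = 0 then 1 else 0) (fun x => if x = 1 then 1 else 0) μ V)
    (hmin : curveAction Λ Q μ V =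
      Wsq Λ Q (fun x => if x = 0 then 1 else 0) (fun x => if x = 1 then 1 else 0)) :
    ∃ t ∈ Set.Ioo (0 : ℝ) 1, 0 < μ t 2 := by
  by_contra! hcon
  have hQ := hMT.1
  have hμ2 : ∀ t ∈ Set.Icc (0 : ℝ) 1, μ t 2 = 0 := by
    intro t ht
    rcases eq_or_lt_of_le ht.1 with rfl | h0
    · simp [hCE.2.2.2.1]
    rcases eq_or_lt_of_le ht.2 with rfl | h1
    · simp [hCE.2.2.2.2.1]
    exact le_antisymm (hcon t ⟨h0, h1⟩) ((hCE.2.2.1 t ht).1 2)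
  obtain ⟨q, hq, hqQ⟩ : ∃ q : ℝ, 0 < q ∧ ∀ x y, x ≠ y → q ≤ Q x y := by
    obtain ⟨p, hp, hmin⟩ := Finset.exists_min_image
      (Finset.univ.filter fun p : Fin 3 × Fin 3 => p.1 ≠ p.2) (fun p => Q p.1 p.2) ⟨(0, 1), by simp⟩
    exact ⟨Q p.1 p.2, hQpos _ _ (by simpa using hp),
      fun x y hxy => hmin (x, y) (by simpa using hxy)⟩
  have hfin : curveAction Λ Q μ V ≠ ⊤ := by
    rw [hmin]
    exact ne_top_of_le_ne_top (curveAction_detour_ne_top hΛ hq hqQ hQ)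
      (iInf_le_of_le _ (iInf_le_of_le _ (iInf_le _ (isCE1_detour le_rfl))))
  have hne : curveAction Λ Q μ V ≠ 0 := by
    refine curveAction_ne_zero hΛ hQ (fun h => ?_) hCE
    simpa using congrFun h 0
  obtain ⟨w, hw, hwA⟩ : ∃ w : ℝ, 0 < w ∧ curveAction Λ Q μ V = ENNReal.ofReal w :=
    ⟨_, ENNReal.toReal_pos hne hfin, (ENNReal.ofReal_toReal hfin).symm⟩
  obtain ⟨k, hk, h0, h1⟩ := hCE.exists_two_le
  have hk0 : 0 < k := two_pos.trans_le hk
  obtain ⟨η, hη, hηw⟩ : ∃ η : ℝ, 0 < η ∧ 9 * (144 * k ^ 2 * η / q) = w / 2 :=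
    ⟨w * q / (2592 * k ^ 2), by positivity, by field_simp; norm_num⟩
  obtain ⟨δ, hδ, hslope⟩ := hΛ.exists_le_mul (hΛtop 1 one_pos)
    (by positivity : 0 < q / 4) hη
  obtain ⟨ε, hε, hε', hεδ⟩ : ∃ ε : ℝ, 0 < ε ∧ ε ≤ 1 / 2 ∧ ε * q ≤ δ :=
    ⟨min (1 / 2) (δ / q), lt_min (by norm_num) (by positivity), min_le_left _ _,
      (le_div_iff₀ hq).1 (min_le_right _ _)⟩
  have hmix := curveAction_mix_le hΛ hq hqQ hQ (V := V) hk h0 h1 hμ2 hε hε' hη.le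
    fun s hs hsε => hslope s hs (hsε.trans hεδ)
  have hWle : curveAction Λ Q μ V ≤ _ := hmin.le.trans
    (iInf_le_of_le _ (iInf_le_of_le _ (iInf_le _
      (hCE.mix (isCE1_detour hk) hε.le (by linarith : ε ≤ 1)))))
  have hle := hWle.trans hmix
  rw [hwA, ← ENNReal.ofReal_mul (by linarith), ← ENNReal.ofReal_add
    (mul_nonneg (by linarith) hw.le) (by positivity), ENNReal.ofReal_le_ofReal_iff
    (add_nonneg (mul_nonneg (by linarith) hw.le) (by positivity))] at hle
  nlinarith [mul_pos hε hw]
end
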